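/- arXiv:2407.19223 — 2 statements merged into one kernel-verified Lean document; each statement's English description precedes it below -/
import Mathlib

section
/- For every integer n ≥ 2, every integer ν with 1 ≤ ν ≤ n − 1, and every integer N ≥ 2, there exists λ with 0 < λ < 1 such that C_n(ν) = −(2n/π)·ln(2·sin(πν/n)) + 2·Σ_{r=1}^{N−1} (1 − 2^{1−2r})·π^{2r−1}·B_{2r}·ℋ_{2r−1}(ν/n) / ((2r)!·n^{2r−1}) + 2λ·(1 − 2^{1−2N})·π^{2N−1}·B_{2N}·ℋ_{2N−1}(ν/n) / ((2N)!·n^{2N−1}), where ℋ_{2r−1}(x) := −π^{−2r}·(Ψ_{2r−1}(x) + Ψ_{2r−1}(1 − x)); moreover ℋ_{2r−1}(ν/n) < 0 for every r ≥ 1. -/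
open Real Finset

/-- `C n ν = Σ_{l=1}^{n-1} cos(2πνl/n) · csc(πl/n)`. -/
noncomputable def C (n : ℕ) (ν : ℤ) : ℝ :=
  ∑ l ∈ Finset.Icc 1 (n - 1), Real.cos (2 * π * ν * l / n) / Real.sin (π * l / n)

/-- The digamma function `Ψ = Γ'/Γ`. -/
noncomputable def digamma (x : ℝ) : ℝ := deriv Real.Gamma x / Real.Gamma x

/-- The polygamma function of order `m`: the `m`-th derivative of the digamma function. -/
noncomputable def polygamma (m : ℕ) (x : ℝ) : ℝ := iteratedDeriv m digamma x

/-- `ℋ_{2r-1}(x) = -π^{-2r} (Ψ_{2r-1}(x) + Ψ_{2r-1}(1-x))`. -/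
noncomputable def Hcal (r : ℕ) (x : ℝ) : ℝ :=
  -(polygamma (2 * r - 1) x + polygamma (2 * r - 1) (1 - x)) / π ^ (2 * r)

section

open MeasureTheory Filter Topology

theorem integrableOn_pow_mul_exp_neg_mul (k : ℕ) {b : ℝ} (hb : 0 < b) :
    IntegrableOn (fun t : ℝ => t ^ k * exp (-(b * t))) (Set.Ioi 0) := by
  have h := integrableOn_rpow_mul_exp_neg_mul_rpow (p := 1) (s := k) (b := b)
    (by have : (0:ℝ) ≤ k := k.cast_nonneg
        linarith) zero_lt_one hb
  simpa using h

theorem integral_pow_mul_exp_neg_mul (k : ℕ) {b : ℝ} (hb : 0 < b) :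
    ∫ t in Set.Ioi (0 : ℝ), t ^ k * exp (-(b * t)) = k.factorial / b ^ (k + 1) := by
  have h := Real.integral_rpow_mul_exp_neg_mul_Ioi (a := k + 1) (r := b) (by positivity) hb
  rw [Real.Gamma_nat_eq_factorial] at h
  simp only [add_sub_cancel_right, rpow_natCast] at h
  rw [h]
  norm_cast
  rw [one_div, inv_pow]
  field_simp

theorem tsum_sub_two_mul_tsum_odd_pos {φ : ℕ → ℝ} (hs : Summable φ) (ha : StrictAnti φ) :
    0 < ∑' i, φ i - 2 * ∑' i, φ (2 * i + 1) := by
  have h1 : Summable fun i => φ (2 * i) := hs.comp_injective fun a b h => by simpa using h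
  have h2 : Summable fun i => φ (2 * i + 1) := hs.comp_injective fun a b h => by simpa using h
  have h := h2.tsum_lt_tsum (fun i => (ha (Nat.lt_succ_self (2 * i))).le)
    (ha (Nat.lt_succ_self (2 * 0))) h1
  rw [← tsum_even_add_odd h1 h2]
  linarith

theorem hasSum_coth {s : ℝ} (hs : 0 < s) :
    HasSum (fun i : ℕ => 2 * s / (s ^ 2 + ((i : ℝ) + 1) ^ 2))
      (π * (cosh (π * s) / sinh (π * s)) - 1 / s) := by
  have hx : ((s : ℂ) * Complex.I) ∈ Complex.integerComplement := by
    rintro ⟨n, hn⟩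
    have := congrArg Complex.im hn
    simp at this
    exact hs.ne this
  have h := ((summable_cotTerm hx).hasSum_iff).2 (cot_series_rep' hx).symm
  have h2 := h.mul_left Complex.I
  have hs' : (s : ℂ) ≠ 0 := by exact_mod_cast hs.ne'
  rw [← Complex.hasSum_ofReal]
  convert! h2 using 1
  · ext i
    rw [cotTerm_identity hx]
    have h0 : (s : ℂ) ^ 2 + ((i : ℂ) + 1) ^ 2 ≠ 0 := by
      have : s ^ 2 + ((i : ℝ) + 1) ^ 2 ≠ 0 := by positivity
      exact_mod_cast this
    have h1 : ((s : ℂ) * Complex.I + (i + 1)) * (s * Complex.I - (i + 1))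
        = -(s ^ 2 + (i + 1) ^ 2) := by
      linear_combination (s : ℂ) ^ 2 * Complex.I_sq
    rw [h1]
    push_cast
    field_simp
    linear_combination Complex.I_sq
  · have hsh : Complex.sinh (π * s) ≠ 0 := by
      have : sinh (π * s) ≠ 0 := by simp [pi_ne_zero, hs.ne']
      exact_mod_cast this
    rw [← mul_assoc, Complex.cot, Complex.cos_mul_I, Complex.sin_mul_I]
    push_cast
    field_simp

/-- The terms `c ^ (-2 * M) / (t ^ 2 + c ^ 2)`, where `c = 2 π (i + 1)`. -/
noncomputable def poleTerm (t : ℝ) (M i : ℕ) : ℝ :=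
  1 / ((2 * π * (i + 1)) ^ (2 * M) * (t ^ 2 + (2 * π * (i + 1)) ^ 2))

theorem strictAnti_poleTerm (t : ℝ) (M : ℕ) : StrictAnti (poleTerm t M) := by
  intro i j hij
  have hij' : (i : ℝ) < j := by exact_mod_cast hij
  unfold poleTerm
  refine one_div_lt_one_div_of_lt (by positivity)
    (mul_lt_mul' (by gcongr) (by gcongr) (by positivity) (by positivity))

theorem summable_inv_two_pi_mul_pow (M : ℕ) :
    Summable fun i : ℕ => 1 / (2 * π * ((i : ℝ) + 1)) ^ (2 * M + 2) := by
  have h : Summable fun i : ℕ => 1 / ((i : ℝ) + 1) ^ (2 * M + 2) := by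
    have := (summable_nat_add_iff 1).2
      (Real.summable_one_div_nat_pow (p := 2 * M + 2).2 (by omega))
    simpa using this
  refine (h.mul_left (1 / (2 * π) ^ (2 * M + 2))).congr fun i => ?_
  rw [mul_pow (2 * π), one_div_mul_one_div]

theorem poleTerm_add (t : ℝ) (M i : ℕ) :
    poleTerm t M i + t ^ 2 * poleTerm t (M + 1) i = 1 / (2 * π * (i + 1)) ^ (2 * M + 2) := by
  unfold poleTerm
  have : 2 * π * ((i : ℝ) + 1) ≠ 0 := by positivity
  have : t ^ 2 + (2 * π * ((i : ℝ) + 1)) ^ 2 ≠ 0 := by positivity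
  field_simp
  ring

theorem poleTerm_pos (t : ℝ) (M i : ℕ) : 0 < poleTerm t M i := by
  unfold poleTerm
  positivity

theorem summable_poleTerm (t : ℝ) (M : ℕ) : Summable (poleTerm t M) := by
  refine (summable_inv_two_pi_mul_pow M).of_nonneg_of_le (fun i => (poleTerm_pos t M i).le)
    fun i => ?_
  rw [← poleTerm_add t M i]
  have := mul_nonneg (sq_nonneg t) (poleTerm_pos t (M + 1) i).le
  linarith

/-- The alternating sum of the `poleTerm t M i`. -/
noncomputable def poleSum (t : ℝ) (M : ℕ) : ℝ :=
  ∑' i, poleTerm t M i - 2 * ∑' i, poleTerm t M (2 * i + 1)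

theorem poleSum_pos (t : ℝ) (M : ℕ) : 0 < poleSum t M :=
  tsum_sub_two_mul_tsum_odd_pos (summable_poleTerm t M) (strictAnti_poleTerm t M)

/-- The coefficients of the midpoint expansion of the digamma function. -/
noncomputable def midCoeff (M : ℕ) : ℝ :=
  (1 - 2 / 4 ^ (M + 1)) * (bernoulli (2 * M + 2) : ℝ) / (2 * M + 2)

theorem poleSum_add (t : ℝ) (M : ℕ) :
    poleSum t M + t ^ 2 * poleSum t (M + 1)
      = (-1) ^ M * midCoeff M / (2 * (2 * M + 1).factorial) := by
  have hodd : Function.Injective fun i : ℕ => 2 * i + 1 := fun a b h => by simpa using h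
  have hz : ∑' i : ℕ, 1 / ((i : ℝ) + 1) ^ (2 * M + 2) = (-1 : ℝ) ^ M * (2 : ℝ) ^ (2 * M + 1)
      * π ^ (2 * M + 2) * bernoulli (2 * M + 2) / (2 * M + 2).factorial := by
    have h := hasSum_zeta_nat (k := M + 1) (by omega)
    rw [show 2 * (M + 1) = 2 * M + 2 by ring, show 2 * M + 2 - 1 = 2 * M + 1 by omega,
      show M + 1 + 1 = M + 2 by ring, pow_add (-1 : ℝ) M 2] at h
    have h' := (hasSum_nat_add_iff' 1).2 h
    simp only [Finset.sum_range_one] at h'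
    convert! h'.tsum_eq using 1
    · simp
    · simp
  have e1 : ∀ i : ℕ, 1 / (2 * π * ((i : ℝ) + 1)) ^ (2 * M + 2)
      = 1 / (2 * π) ^ (2 * M + 2) * (1 / ((i : ℝ) + 1) ^ (2 * M + 2)) := by
    intro i
    rw [mul_pow]
    field_simp
  have e2 : ∀ i : ℕ, 1 / (2 * π * (((2 * i + 1 : ℕ) : ℝ) + 1)) ^ (2 * M + 2)
      = 1 / (2 * π) ^ (2 * M + 2) * (1 / 4 ^ (M + 1)) * (1 / ((i : ℝ) + 1) ^ (2 * M + 2)) := by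
    intro i
    rw [show (4 : ℝ) = 2 ^ 2 by norm_num, ← pow_mul, show 2 * (M + 1) = 2 * M + 2 by ring]
    push_cast
    rw [show 2 * π * (2 * (i : ℝ) + 1 + 1) = 2 * π * 2 * (i + 1) by ring, mul_pow, mul_pow]
    field_simp
  have h1 : ∑' i, poleTerm t M i + t ^ 2 * ∑' i, poleTerm t (M + 1) i
      = ∑' i : ℕ, 1 / (2 * π * ((i : ℝ) + 1)) ^ (2 * M + 2) := by
    rw [← tsum_mul_left, ← Summable.tsum_add (summable_poleTerm t M)
      ((summable_poleTerm t (M + 1)).mul_left _)]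
    exact tsum_congr fun i => poleTerm_add t M i
  have h2 : ∑' i, poleTerm t M (2 * i + 1) + t ^ 2 * ∑' i, poleTerm t (M + 1) (2 * i + 1)
      = ∑' i : ℕ, 1 / (2 * π * (((2 * i + 1 : ℕ) : ℝ) + 1)) ^ (2 * M + 2) := by
    have s0 : Summable fun i => poleTerm t M (2 * i + 1) :=
      (summable_poleTerm t M).comp_injective hodd
    have s1 : Summable fun i => poleTerm t (M + 1) (2 * i + 1) :=
      (summable_poleTerm t (M + 1)).comp_injective hodd
    rw [← tsum_mul_left, ← s0.tsum_add (s1.mul_left _)]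
    exact tsum_congr fun i => poleTerm_add t M (2 * i + 1)
  simp_rw [e1] at h1
  simp_rw [e2] at h2
  rw [tsum_mul_left, hz] at h1 h2
  unfold poleSum midCoeff
  have hf : (((2 * M + 2).factorial : ℕ) : ℝ) = (2 * M + 2) * (2 * M + 1).factorial := by
    rw [Nat.factorial_succ]
    push_cast
    ring
  rw [hf] at h1 h2
  rw [show ∀ a b c d : ℝ, a - 2 * b + t ^ 2 * (c - 2 * d) = (a + t ^ 2 * c) - 2 * (b + t ^ 2 * d)
    from fun a b c d => by ring, h1, h2, mul_pow]
  field_simp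
  ring

theorem sub_csch_eq_poleSum {t : ℝ} (ht : 0 < t) :
    1 / t - 1 / (2 * sinh (t / 2)) = 2 * t * poleSum t 0 := by
  have hp := pi_pos
  have h1 := (hasSum_coth (s := t / (2 * π)) (by positivity)).mul_left (1 / (2 * π))
  have h2 := (hasSum_coth (s := t / (4 * π)) (by positivity)).mul_left (1 / (2 * π))
  have e1 : HasSum (fun i => 2 * t * poleTerm t 0 i)
      (1 / 2 * (cosh (t / 2) / sinh (t / 2)) - 1 / t) := by
    convert! h1 using 1
    · ext i
      unfold poleTerm
      have : t ^ 2 + (2 * π * ((i : ℝ) + 1)) ^ 2 ≠ 0 := by positivity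
      have : (t / (2 * π)) ^ 2 + ((i : ℝ) + 1) ^ 2 ≠ 0 := by positivity
      field_simp
      ring
    · rw [show π * (t / (2 * π)) = t / 2 by field_simp]
      field_simp
  have e2 : HasSum (fun i => 4 * t * poleTerm t 0 (2 * i + 1))
      (1 / 2 * (cosh (t / 4) / sinh (t / 4)) - 2 / t) := by
    convert! h2 using 1
    · ext i
      unfold poleTerm
      push_cast
      have : t ^ 2 + (2 * π * (2 * (i : ℝ) + 1 + 1)) ^ 2 ≠ 0 := by positivity
      have : (t / (4 * π)) ^ 2 + ((i : ℝ) + 1) ^ 2 ≠ 0 := by positivity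
      field_simp
      ring
    · rw [show π * (t / (4 * π)) = t / 4 by field_simp]
      field_simp
      ring
  have s1 := e1.tsum_eq
  have s2 := e2.tsum_eq
  rw [tsum_mul_left] at s1 s2
  have : 2 * t * poleSum t 0 = 2 * t * ∑' i, poleTerm t 0 i
      - 4 * t * ∑' i, poleTerm t 0 (2 * i + 1) := by
    unfold poleSum
    ring
  rw [this, s1, s2]
  have hs : sinh (t / 4) ≠ 0 := by simp [ht.ne']
  have hc : cosh (t / 4) ≠ 0 := (cosh_pos _).ne'
  rw [show t / 2 = 2 * (t / 4) by ring, sinh_two_mul, cosh_two_mul]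
  field_simp
  linear_combination t * cosh_sq (t / 4)

theorem sub_csch_sub_sum {t : ℝ} (ht : 0 < t) (M : ℕ) :
    1 / t - 1 / (2 * sinh (t / 2))
        - ∑ r ∈ range M, midCoeff r * t ^ (2 * r + 1) / (2 * r + 1).factorial
      = (-1) ^ M * (2 * t ^ (2 * M + 1) * poleSum t M) := by
  induction M with
  | zero => simpa using sub_csch_eq_poleSum ht
  | succ M ih =>
    rw [sum_range_succ, ← sub_sub, ih]
    have h := poleSum_add t M
    have h1 : midCoeff M * t ^ (2 * M + 1) / (2 * M + 1).factorial
        = (-1) ^ M * 2 * t ^ (2 * M + 1) * (poleSum t M + t ^ 2 * poleSum t (M + 1)) := by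
      have hm : ((-1 : ℝ) ^ M) * (-1) ^ M = 1 := by
        rw [← mul_pow]; simp
      rw [h]
      field_simp
      linear_combination (-midCoeff M) * hm
    rw [h1]
    ring

/-- The error of the midpoint expansion of `log (x + 1) - log x` with `M` correction terms. -/
noncomputable def midStep (M : ℕ) (x : ℝ) : ℝ :=
  log (x + 1) - log x - 1 / (x + 1 / 2)
    - ∑ r ∈ range M, midCoeff r * (1 / x ^ (2 * r + 2) - 1 / (x + 1) ^ (2 * r + 2))

/-- The Laplace density of `-deriv (midStep M)`. -/
noncomputable def midStepDensity (M : ℕ) (x t : ℝ) : ℝ :=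
  t ^ 0 * exp (-(x * t)) - t ^ 0 * exp (-((x + 1) * t)) - t ^ 1 * exp (-((x + 1 / 2) * t))
    - ∑ r ∈ range M, midCoeff r / (2 * r + 1).factorial
        * (t ^ (2 * r + 2) * exp (-(x * t)) - t ^ (2 * r + 2) * exp (-((x + 1) * t)))

theorem integrableOn_midStepDensity (M : ℕ) {x : ℝ} (hx : 0 < x) :
    IntegrableOn (midStepDensity M x) (Set.Ioi 0) := by
  unfold midStepDensity
  refine Integrable.sub (Integrable.sub (Integrable.sub ?_ ?_) ?_)
    (integrable_finsetSum _ fun r _ => Integrable.const_mul (Integrable.sub ?_ ?_) _)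
  all_goals exact integrableOn_pow_mul_exp_neg_mul _ (by linarith)

theorem integral_midStepDensity (M : ℕ) {x : ℝ} (hx : 0 < x) :
    ∫ t in Set.Ioi 0, midStepDensity M x t
      = 1 / x - 1 / (x + 1) - 1 / (x + 1 / 2) ^ 2
        - ∑ r ∈ range M, midCoeff r
          * ((2 * r + 2) / x ^ (2 * r + 3) - (2 * r + 2) / (x + 1) ^ (2 * r + 3)) := by
  have i0 (k : ℕ) := integrableOn_pow_mul_exp_neg_mul k hx
  have i1 (k : ℕ) := integrableOn_pow_mul_exp_neg_mul k (b := x + 1) (by linarith)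
  have i2 (k : ℕ) := integrableOn_pow_mul_exp_neg_mul k (b := x + 1 / 2) (by linarith)
  have is (r : ℕ) : Integrable (fun t => midCoeff r / (2 * r + 1).factorial
        * (t ^ (2 * r + 2) * exp (-(x * t)) - t ^ (2 * r + 2) * exp (-((x + 1) * t))))
        (volume.restrict (Set.Ioi 0)) :=
    Integrable.const_mul (Integrable.sub (i0 _) (i1 _)) _
  have j1 : Integrable (fun t : ℝ => t ^ 0 * exp (-(x * t)) - t ^ 0 * exp (-((x + 1) * t)))
      (volume.restrict (Set.Ioi 0)) := (i0 0).sub (i1 0)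
  have j2 : Integrable (fun t : ℝ => t ^ 0 * exp (-(x * t)) - t ^ 0 * exp (-((x + 1) * t))
      - t ^ 1 * exp (-((x + 1 / 2) * t))) (volume.restrict (Set.Ioi 0)) := j1.sub (i2 1)
  unfold midStepDensity
  rw [integral_sub j2 (integrable_finsetSum _ fun r _ => is r), integral_sub j1 (i2 1),
    integral_sub (i0 0) (i1 0),
    integral_finsetSum _ fun r _ => is r, integral_pow_mul_exp_neg_mul _ hx,
    integral_pow_mul_exp_neg_mul _ (by linarith), integral_pow_mul_exp_neg_mul _ (by linarith)]
  congr 1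
  · simp
  · refine sum_congr rfl fun r _ => ?_
    rw [integral_const_mul, integral_sub (i0 _) (i1 _), integral_pow_mul_exp_neg_mul _ hx,
      integral_pow_mul_exp_neg_mul _ (by linarith), Nat.factorial_succ (2 * r + 1)]
    push_cast
    field_simp
    ring

theorem midStepDensity_eq (M : ℕ) (x : ℝ) {t : ℝ} (ht : 0 < t) :
    midStepDensity M x t = (-1) ^ M
      * (exp (-(x * t)) * (1 - exp (-t)) * (2 * t ^ (2 * M + 2) * poleSum t M)) := by
  have h := sub_csch_sub_sum ht M
  have hsplit : exp (-((x + 1) * t)) = exp (-(x * t)) * exp (-t) := by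
    rw [← exp_add]; ring_nf
  have hhalf : exp (-((x + 1 / 2) * t)) = exp (-(x * t)) * exp (-(t / 2)) := by
    rw [← exp_add]; ring_nf
  have hsinh : (1 - exp (-t)) * (1 / (2 * sinh (t / 2))) = exp (-(t / 2)) := by
    have h0 : sinh (t / 2) ≠ 0 := by simp [ht.ne']
    rw [mul_one_div, div_eq_iff (by positivity), sinh_eq]
    have e1 : exp (-(t / 2)) * exp (t / 2) = 1 := by rw [← exp_add]; simp
    have e2 : exp (-(t / 2)) * exp (-(t / 2)) = exp (-t) := by rw [← exp_add]; ring_nf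
    linear_combination e2 - e1
  have hsum : ∑ r ∈ range M, midCoeff r / (2 * r + 1).factorial
        * (t ^ (2 * r + 2) * exp (-(x * t)) - t ^ (2 * r + 2) * exp (-((x + 1) * t)))
      = exp (-(x * t)) * (1 - exp (-t)) * t
        * ∑ r ∈ range M, midCoeff r * t ^ (2 * r + 1) / (2 * r + 1).factorial := by
    rw [mul_sum]
    refine sum_congr rfl fun r _ => ?_
    rw [hsplit]
    ring
  have ht1 : t * (1 / t) = 1 := by field_simp
  unfold midStepDensity
  rw [hsum, hsplit, hhalf]
  linear_combination exp (-(x * t)) * (1 - exp (-t)) * t * h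
    - exp (-(x * t)) * (1 - exp (-t)) * ht1 + exp (-(x * t)) * t * hsinh

theorem integral_midStepDensity_pos (M : ℕ) {x : ℝ} (hx : 0 < x) :
    0 < (-1) ^ M * ∫ t in Set.Ioi 0, midStepDensity M x t := by
  have hpos : ∀ t ∈ Set.Ioi (0 : ℝ), 0 < (-1) ^ M * midStepDensity M x t := by
    intro t ht
    have ht : 0 < t := ht
    have h1 := poleSum_pos t M
    have h2 : 0 < 1 - exp (-t) := by
      have : exp (-t) < 1 := by rw [exp_lt_one_iff]; linarith
      linarith
    rw [midStepDensity_eq M x ht, ← mul_assoc, ← mul_pow]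
    simp only [mul_neg, mul_one, neg_neg, one_pow, one_mul]
    positivity
  have hsup : (Function.support fun t => (-1) ^ M * midStepDensity M x t) ∩ Set.Ioi 0
      = Set.Ioi 0 := Set.inter_eq_right.2 fun t ht => (hpos t ht).ne'
  rw [← integral_const_mul, setIntegral_pos_iff_support_of_nonneg_ae
    ((ae_restrict_mem measurableSet_Ioi).mono fun t ht => (hpos t ht).le)
    ((integrableOn_midStepDensity M hx).const_mul _), hsup]
  simp

theorem hasDerivAt_one_div_pow (k : ℕ) (c : ℝ) {x : ℝ} (hx : x + c ≠ 0) :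
    HasDerivAt (fun x : ℝ => 1 / (x + c) ^ k) (-(k / (x + c) ^ (k + 1))) x := by
  have h := ((((hasDerivAt_id x).add_const c).pow k).inv (pow_ne_zero k hx))
  simp only [one_div]
  convert! h using 1
  rcases k with _ | k
  · simp
  · simp
    field_simp
    ring

theorem hasDerivAt_midStep (M : ℕ) {x : ℝ} (hx : 0 < x) :
    HasDerivAt (midStep M) (-∫ t in Set.Ioi 0, midStepDensity M x t) x := by
  have h1 := ((hasDerivAt_id x).add_const 1).log (by simp; linarith)
  have h2 := (hasDerivAt_id x).log hx.ne'
  have h3 := hasDerivAt_one_div_pow 1 (1 / 2) (x := x) (by linarith)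
  have h4 := HasDerivAt.fun_sum (u := range M) fun r _ =>
    ((by simpa using hasDerivAt_one_div_pow (2 * r + 2) 0 (x := x) (by linarith) :
      HasDerivAt (fun x : ℝ => 1 / x ^ (2 * r + 2)) (-((2 * r + 2) / x ^ (2 * r + 2 + 1))) x).sub
      (hasDerivAt_one_div_pow (2 * r + 2) 1 (x := x) (by linarith))).const_mul (midCoeff r)
  have h := ((h1.sub h2).sub h3).sub h4
  rw [integral_midStepDensity M hx]
  convert! h using 1
  · ext y
    simp [midStep]
  · simp only [neg_sub, id]
    have : ∀ r : ℕ, midCoeff r * (-((2 * (r : ℝ) + 2) / x ^ (2 * r + 2 + 1))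
        - -(((2 * r + 2 : ℕ) : ℝ) / (x + 1) ^ (2 * r + 2 + 1)))
      = -(midCoeff r * ((2 * r + 2) / x ^ (2 * r + 3) - (2 * r + 2) / (x + 1) ^ (2 * r + 3))) := by
      intro r
      push_cast
      ring
    simp_rw [this, sum_neg_distrib]
    push_cast
    ring

theorem tendsto_one_div_pow_atTop (k : ℕ) (c : ℝ) :
    Tendsto (fun x : ℝ => 1 / (x + c) ^ (k + 1)) atTop (𝓝 0) := by
  simp only [one_div]
  exact tendsto_inv_atTop_zero.comp ((tendsto_pow_atTop (by omega)).comp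
    (tendsto_atTop_add_const_right _ c tendsto_id))

theorem tendsto_midStep (M : ℕ) : Tendsto (midStep M) atTop (𝓝 0) := by
  have h1 : Tendsto (fun x : ℝ => log (x + 1) - log x) atTop (𝓝 0) := by
    have h : Tendsto (fun x : ℝ => log (1 + x⁻¹)) atTop (𝓝 (log (1 + 0))) :=
      (continuousAt_log (by norm_num)).tendsto.comp
        (tendsto_const_nhds.add tendsto_inv_atTop_zero)
    rw [add_zero, log_one] at h
    refine h.congr' ?_
    filter_upwards [eventually_gt_atTop 0] with x hx
    rw [← log_div (by positivity) hx.ne']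
    congr 1
    field_simp
  have h2 := tendsto_one_div_pow_atTop 0 (1 / 2)
  have h3 := tendsto_finsetSum (range M) fun r _ =>
    ((tendsto_one_div_pow_atTop (2 * r + 1) 0).sub
      (tendsto_one_div_pow_atTop (2 * r + 1) 1)).const_mul (midCoeff r)
  have h := (h1.sub h2).sub h3
  simp only [sub_self, mul_zero, sum_const_zero, add_zero, zero_add, pow_one] at h
  exact h

theorem midStep_sign (M : ℕ) {x : ℝ} (hx : 0 < x) : 0 < (-1) ^ M * midStep M x := by
  have hd : ∀ y ∈ Set.Ioi (0 : ℝ), HasDerivAt (fun y => (-1) ^ M * midStep M y)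
      ((-1) ^ M * -∫ t in Set.Ioi 0, midStepDensity M y t) y :=
    fun y hy => (hasDerivAt_midStep M hy).const_mul _
  have hanti : StrictAntiOn (fun y => (-1) ^ M * midStep M y) (Set.Ioi 0) := by
    refine strictAntiOn_of_deriv_neg (convex_Ioi 0)
      (fun y hy => (hd y hy).continuousAt.continuousWithinAt) fun y hy => ?_
    rw [interior_Ioi] at hy
    rw [(hd y hy).deriv]
    have := integral_midStepDensity_pos M (x := y) hy
    linarith
  have hlim : Tendsto (fun y => (-1) ^ M * midStep M y) atTop (𝓝 0) := by
    simpa using (tendsto_midStep M).const_mul ((-1) ^ M)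
  have h1 : 0 ≤ (-1) ^ M * midStep M (x + 1) := by
    refine le_of_tendsto hlim ((eventually_ge_atTop (x + 1)).mono fun y hy => ?_)
    exact hanti.antitoneOn (show (0 : ℝ) < x + 1 by linarith)
      (show (0 : ℝ) < y by linarith) hy
  have h2 := hanti (a := x) (b := x + 1) hx (show (0:ℝ) < x + 1 by linarith) (by linarith)
  simp only at h2
  linarith

theorem pos_of_tendsto_zero {f : ℕ → ℝ} (hf : ∀ m, 1 ≤ m → f (m + 1) < f m)
    (h0 : Tendsto f atTop (𝓝 0)) {m : ℕ} (hm : 1 ≤ m) : 0 < f m := by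
  have ha : StrictAnti fun j => f (m + j) :=
    strictAnti_nat_of_succ_lt fun j => hf (m + j) (by omega)
  have hl : Tendsto (fun j => f (m + j)) atTop (𝓝 0) := by
    simpa only [add_comm] using (tendsto_add_atTop_iff_nat m).2 h0
  exact (ha.antitone.le_of_tendsto hl 1).trans_lt (ha zero_lt_one)

theorem midStep_succ (M : ℕ) (x : ℝ) :
    midStep (M + 1) x
      = midStep M x - midCoeff M * (1 / x ^ (2 * M + 2) - 1 / (x + 1) ^ (2 * M + 2)) := by
  unfold midStep
  rw [sum_range_succ]
  ring

theorem summable_midStep_zero : Summable fun j : ℕ => midStep 0 (j : ℝ) := by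
  rw [← summable_nat_add_iff 1]
  have hs : Summable fun j : ℕ => midCoeff 0 * (1 / ((j + 1 : ℕ) : ℝ) ^ 2) :=
    ((summable_nat_add_iff 1).2 (Real.summable_one_div_nat_pow.2 one_lt_two)).mul_left _
  have hc : 0 < midCoeff 0 := by norm_num [midCoeff]
  refine Summable.of_nonneg_of_le (fun j => ?_) (fun j => ?_) hs
  · have := midStep_sign 0 (x := ((j + 1 : ℕ) : ℝ)) (by positivity)
    simpa using this.le
  · have h := midStep_sign 1 (x := ((j + 1 : ℕ) : ℝ)) (by positivity)
    rw [midStep_succ 0] at h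
    have h2 : 0 ≤ midCoeff 0 * (1 / (((j + 1 : ℕ) : ℝ) + 1) ^ (2 * 0 + 2)) := by positivity
    rw [mul_sub] at h
    norm_num at h h2 ⊢
    linarith

/-- The sum of the errors `midStep 0 j` over `j ≥ m`. -/
noncomputable def midTail (m : ℕ) : ℝ := ∑' j : ℕ, midStep 0 ((j + m : ℕ) : ℝ)

theorem midTail_sub_midTail_succ (m : ℕ) : midTail m - midTail (m + 1) = midStep 0 m := by
  have h := ((summable_nat_add_iff m).2 summable_midStep_zero).tsum_eq_zero_add
  unfold midTail
  rw [h]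
  simp only [zero_add, add_assoc, add_comm 1 m]
  ring

theorem tendsto_midTail : Tendsto midTail atTop (𝓝 0) :=
  tendsto_sum_nat_add fun j : ℕ => midStep 0 (j : ℝ)

/-- The error of the asymptotic expansion of `midTail` with `M` terms. -/
noncomputable def midTailError (M m : ℕ) : ℝ :=
  midTail m - ∑ r ∈ range M, midCoeff r / (m : ℝ) ^ (2 * r + 2)

theorem midTailError_sub_midTailError_succ (M m : ℕ) :
    midTailError M m - midTailError M (m + 1) = midStep M m := by
  have h := midTail_sub_midTail_succ m
  have h2 : midStep M m = midStep 0 m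
      - ∑ r ∈ range M, midCoeff r * (1 / (m : ℝ) ^ (2 * r + 2) - 1 / ((m : ℝ) + 1) ^ (2 * r + 2)) := by
    simp [midStep]
  unfold midTailError
  rw [h2, ← h]
  simp_rw [mul_sub, mul_one_div, sum_sub_distrib]
  push_cast
  ring

theorem tendsto_midTailError (M : ℕ) : Tendsto (midTailError M) atTop (𝓝 0) := by
  have h3 := tendsto_finsetSum (range M) fun r _ =>
    ((tendsto_one_div_pow_atTop (2 * r + 1) 0).comp tendsto_natCast_atTop_atTop).const_mul
      (midCoeff r)
  have h := tendsto_midTail.sub h3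
  simp only [mul_zero, sum_const_zero, sub_zero, Function.comp_def, add_zero, mul_one_div] at h
  exact h

theorem midTailError_sign (M : ℕ) {m : ℕ} (hm : 1 ≤ m) : 0 < (-1) ^ M * midTailError M m := by
  refine pos_of_tendsto_zero (f := fun m => (-1) ^ M * midTailError M m) (fun m hm => ?_) ?_ hm
  · have h := midStep_sign M (x := (m : ℝ)) (by positivity)
    rw [← midTailError_sub_midTailError_succ] at h
    linarith
  · simpa using (tendsto_midTailError M).const_mul ((-1) ^ M)

theorem midTail_pos {m : ℕ} (hm : 1 ≤ m) : 0 < midTail m := by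
  simpa [midTailError] using midTailError_sign 0 hm

theorem midTail_le {m : ℕ} (hm : 1 ≤ m) : midTail m ≤ midCoeff 0 / (m : ℝ) ^ 2 := by
  have h := midTailError_sign 1 hm
  simp [midTailError] at h
  exact h.le

theorem tendsto_mul_midTail : Tendsto (fun m : ℕ => m * midTail m) atTop (𝓝 0) := by
  have h : Tendsto (fun m : ℕ => midCoeff 0 * (1 / (m : ℝ))) atTop (𝓝 (midCoeff 0 * 0)) :=
    tendsto_one_div_atTop_nhds_zero_nat.const_mul _
  rw [mul_zero] at h
  refine squeeze_zero' ?_ ?_ h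
  · filter_upwards [eventually_ge_atTop 1] with m hm
    have := midTail_pos hm
    positivity
  · filter_upwards [eventually_ge_atTop 1] with m hm
    have h0 : (0 : ℝ) < m := by exact_mod_cast hm
    calc (m : ℝ) * midTail m ≤ m * (midCoeff 0 / (m : ℝ) ^ 2) := by gcongr; exact midTail_le hm
      _ = _ := by field_simp

/-- The harmonic-type numbers `∑ 1 / (j + 1 / 2)`, normalized to be asymptotic to `log`. -/
noncomputable def oddHarmonic (m : ℕ) : ℝ :=
  midTail 1 - 2 + ∑ j ∈ range m, 1 / ((j : ℝ) + 1 / 2)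

theorem oddHarmonic_succ (m : ℕ) :
    oddHarmonic (m + 1) = oddHarmonic m + 1 / ((m : ℝ) + 1 / 2) := by
  unfold oddHarmonic
  rw [sum_range_succ]
  ring

theorem oddHarmonic_eq {m : ℕ} (hm : 1 ≤ m) : oddHarmonic m = midTail m + log m := by
  induction m, hm using Nat.le_induction with
  | base => norm_num [oddHarmonic]
  | succ m hm ih =>
    have h := midTail_sub_midTail_succ m
    simp only [midStep, range_zero, sum_empty, sub_zero] at h
    rw [oddHarmonic_succ, ih]
    push_cast
    linarith

theorem sum_oddHarmonic (M : ℕ) :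
    ∑ m ∈ range M, oddHarmonic m + ∑ m ∈ range M, oddHarmonic (m + 1)
      = 2 * M * (oddHarmonic M - 1) := by
  induction M with
  | zero => simp
  | succ M ih =>
    rw [sum_range_succ, sum_range_succ, oddHarmonic_succ M]
    have h : ((M : ℝ) + 1 / 2) * (1 / ((M : ℝ) + 1 / 2)) = 1 := by
      have : (M : ℝ) + 1 / 2 ≠ 0 := by positivity
      field_simp
    push_cast
    linear_combination ih - 2 * h

theorem tendsto_sum_one_div_sub_one_div {y : ℝ} (h0 : 0 < y) (h1 : y < 1) :
    Tendsto (fun K : ℕ => ∑ k ∈ range K, (1 / ((k : ℝ) + y) - 1 / ((k : ℝ) + 1 - y))) atTop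
      (𝓝 (π * (cos (π * y) / sin (π * y)))) := by
  have hy : (y : ℂ) ∈ Complex.integerComplement := by
    rintro ⟨m, hm⟩
    have hm' : (m : ℝ) = y := by exact_mod_cast hm
    have h2 : 0 < m := by exact_mod_cast hm' ▸ h0
    have h3 : m < 1 := by exact_mod_cast hm' ▸ h1
    omega
  have h := tendsto_logDeriv_euler_cot_sub hy
  have hre : Tendsto (fun K : ℕ => ∑ k ∈ range K, (1 / (y - ((k : ℝ) + 1)) + 1 / (y + ((k : ℝ) + 1))))
      atTop (𝓝 (π * (cos (π * y) / sin (π * y)) - 1 / y)) := by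
    have h' := (Complex.continuous_re.tendsto _).comp h
    have e : (π : ℂ) * Complex.cot (π * y) - 1 / y
        = ((π * (cos (π * y) / sin (π * y)) - 1 / y : ℝ) : ℂ) := by
      rw [Complex.cot]
      push_cast
      rfl
    rw [e, Complex.ofReal_re] at h'
    refine h'.congr fun K => ?_
    rw [Function.comp_apply, ← Complex.ofReal_re (∑ k ∈ range K, _)]
    congr 1
    push_cast
    rfl
  have ht : Tendsto (fun K : ℕ => 1 / ((K : ℝ) + y)) atTop (𝓝 0) := by
    simp only [one_div]
    exact tendsto_inv_atTop_zero.comp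
      (tendsto_atTop_add_const_right _ y tendsto_natCast_atTop_atTop)
  have hall := (hre.const_add (1 / y)).sub ht
  rw [sub_zero, add_sub_cancel] at hall
  refine hall.congr fun K => ?_
  induction K with
  | zero => simp
  | succ K ih =>
    rw [sum_range_succ, sum_range_succ, ← ih, show y - ((K : ℝ) + 1) = -((K : ℝ) + 1 - y) by ring,
      one_div_neg_eq_neg_one_div]
    push_cast
    ring

theorem two_mul_sin_half_mul_sum_sin (a : ℝ) (n : ℕ) :
    2 * sin (a / 2) * ∑ l ∈ range n, sin (a * l) = cos (a / 2) - cos (a * n - a / 2) := by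
  induction n with
  | zero => simp
  | succ n ih =>
    rw [sum_range_succ, mul_add, ih, show a * ((n + 1 : ℕ) : ℝ) - a / 2 = a * n + a / 2 by
      push_cast; ring, cos_sub, cos_add]
    ring

theorem two_mul_sin_half_mul_sum_cos (a : ℝ) (n : ℕ) :
    2 * sin (a / 2) * ∑ l ∈ range n, cos (a * l) = sin (a * n - a / 2) + sin (a / 2) := by
  induction n with
  | zero => simp
  | succ n ih =>
    rw [sum_range_succ, mul_add, ih, show a * ((n + 1 : ℕ) : ℝ) - a / 2 = a * n + a / 2 by
      push_cast; ring, sin_sub, sin_add]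
    ring

theorem sin_pi_mul_div_pos {n l : ℕ} (h1 : 1 ≤ l) (h2 : l < n) : 0 < sin (π * l / n) := by
  have hn : (0 : ℝ) < n := by exact_mod_cast (by omega : 0 < n)
  have hl : (0 : ℝ) < l := by exact_mod_cast h1
  have hln : (l : ℝ) < n := by exact_mod_cast h2
  refine sin_pos_of_pos_of_lt_pi (by positivity) ?_
  rw [div_lt_iff₀ hn]
  exact mul_lt_mul_of_pos_left hln pi_pos

theorem C_succ_sub_C {n : ℕ} (hn : 2 ≤ n) {ν : ℕ} (hν : ν < n) :
    C n ((ν + 1 : ℕ) : ℤ) - C n (ν : ℤ)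
      = -2 * (cos (π * ((ν + 1 / 2) / n)) / sin (π * ((ν + 1 / 2) / n))) := by
  have hn0 : (0 : ℝ) < n := by exact_mod_cast (by omega : 0 < n)
  have hνn : (ν : ℝ) + 1 ≤ n := by exact_mod_cast hν
  set a : ℝ := 2 * (π * ((ν + 1 / 2) / n)) with ha
  have hs : 0 < sin (a / 2) := by
    refine sin_pos_of_pos_of_lt_pi (by positivity) ?_
    have : ((ν : ℝ) + 1 / 2) / n < 1 := by rw [div_lt_one hn0]; linarith
    rw [ha]
    nlinarith [pi_pos]
  have hsum := two_mul_sin_half_mul_sum_sin a n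
  have hcos : cos (a * n - a / 2) = -cos (a / 2) := by
    have : a * n - a / 2 = π - a / 2 + ν * (2 * π) := by
      rw [ha]
      field_simp
      ring
    rw [this, cos_add_nat_mul_two_pi, cos_pi_sub]
  have hIcc : ∑ l ∈ Finset.Icc 1 (n - 1), sin (a * l) = ∑ l ∈ range n, sin (a * l) := by
    rw [range_eq_Ico, sum_eq_sum_Ico_succ_bot (by omega : 0 < n)]
    simp only [Nat.cast_zero, mul_zero, sin_zero, zero_add]
    refine sum_congr ?_ fun _ _ => rfl
    ext l
    simp
    omega
  have hterm : C n ((ν + 1 : ℕ) : ℤ) - C n (ν : ℤ)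
      = -2 * ∑ l ∈ Finset.Icc 1 (n - 1), sin (a * l) := by
    unfold C
    rw [← sum_sub_distrib, mul_sum]
    refine sum_congr rfl fun l hl => ?_
    rw [Finset.mem_Icc] at hl
    have h := sin_pi_mul_div_pos hl.1 (show l < n by omega)
    rw [← sub_div, cos_sub_cos, div_eq_iff h.ne']
    have e1 : (2 * π * ((ν + 1 : ℕ) : ℤ) * l / n + 2 * π * (ν : ℤ) * l / n) / 2 = a * l := by
      rw [ha]
      push_cast
      field_simp
      ring
    have e2 : (2 * π * ((ν + 1 : ℕ) : ℤ) * l / n - 2 * π * (ν : ℤ) * l / n) / 2 = π * l / n := by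
      push_cast
      field_simp
      ring
    rw [e1, e2]
  rw [hterm, hIcc, show π * (((ν : ℝ) + 1 / 2) / n) = a / 2 by rw [ha]; ring]
  rw [hcos] at hsum
  rw [mul_div_assoc', eq_div_iff hs.ne']
  linear_combination -hsum

theorem sum_C_eq_zero {n : ℕ} (hn : 2 ≤ n) : ∑ ν ∈ range n, C n (ν : ℤ) = 0 := by
  have hn0 : (0 : ℝ) < n := by exact_mod_cast (by omega : 0 < n)
  unfold C
  rw [sum_comm]
  refine sum_eq_zero fun l hl => ?_
  rw [Finset.mem_Icc] at hl
  have hs := sin_pi_mul_div_pos hl.1 (show l < n by omega)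
  rw [← sum_div, div_eq_zero_iff]
  left
  have h := two_mul_sin_half_mul_sum_cos (2 * (π * l / n)) n
  have hsin : sin (2 * (π * l / n) * n - 2 * (π * l / n) / 2) = -sin (2 * (π * l / n) / 2) := by
    have : 2 * (π * l / n) * n - 2 * (π * l / n) / 2
        = -(2 * (π * l / n) / 2) + l * (2 * π) := by
      field_simp
      ring
    rw [this, sin_add_nat_mul_two_pi, sin_neg]
  rw [hsin, neg_add_cancel, show 2 * (π * l / n) / 2 = π * l / n by ring] at h
  rcases mul_eq_zero.1 h with h | h
  · exact absurd h (by positivity)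
  · rw [← h]
    refine sum_congr rfl fun ν _ => ?_
    congr 1
    push_cast
    ring

theorem tendsto_log_factorial_sub :
    Tendsto (fun K : ℕ => 2 * log K.factorial - log K - log (2 * π) - 2 * K * (log K - 1)) atTop
      (𝓝 0) := by
  have h := (Stirling.tendsto_stirlingSeq_sqrt_pi.log (by positivity)).const_mul 2
  have h2 := h.sub_const (log π)
  rw [log_sqrt pi_pos.le, mul_div_cancel₀ _ (two_ne_zero' ℝ), sub_self] at h2
  refine h2.congr' ?_
  filter_upwards [eventually_ge_atTop 1] with K hK
  have hK0 : (0 : ℝ) < K := by exact_mod_cast hK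
  rw [Stirling.log_stirlingSeq_formula, log_mul two_ne_zero hK0.ne', log_mul two_ne_zero pi_ne_zero,
    log_div hK0.ne' (exp_pos 1).ne', log_exp]
  ring

theorem tendsto_log_factorial_sub_sum_log {x : ℝ} (h0 : 0 < x) (h1 : x < 1) :
    Tendsto (fun K : ℕ => 2 * log K.factorial - log K - log (2 * π)
      - ∑ k ∈ range K, (log (k + x) + log (k + (1 - x)))) atTop (𝓝 (-log (2 * sin (π * x)))) := by
  have hs : 0 < sin (π * x) := sin_pos_of_pos_of_lt_pi (by positivity) (by nlinarith [pi_pos])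
  rw [← tendsto_add_atTop_iff_nat 1]
  have hg := (BohrMollerup.tendsto_log_gamma h0).add
    (BohrMollerup.tendsto_log_gamma (show 0 < 1 - x by linarith))
  rw [← log_mul (Gamma_pos_of_pos h0).ne' (Gamma_pos_of_pos (by linarith)).ne',
    Gamma_mul_Gamma_one_sub, log_div pi_ne_zero hs.ne'] at hg
  have hl : Tendsto (fun K : ℕ => log ((K : ℝ) + 1) - log K) atTop (𝓝 0) := by
    have ha := (tendsto_midStep 0).comp tendsto_natCast_atTop_atTop
    have hb := (tendsto_one_div_pow_atTop 0 (1 / 2)).comp tendsto_natCast_atTop_atTop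
    simpa [Function.comp_def, midStep] using ha.add hb
  have h := (hg.add hl).sub_const (log (2 * π))
  rw [log_mul two_ne_zero pi_ne_zero] at h
  rw [log_mul two_ne_zero hs.ne',
    show -(log 2 + log (sin (π * x))) = log π - log (sin (π * x)) + 0 - (log 2 + log π) by ring]
  refine h.congr fun K => ?_
  rw [BohrMollerup.logGammaSeq, BohrMollerup.logGammaSeq, Nat.factorial_succ]
  push_cast
  rw [log_mul (by positivity) (by positivity), log_mul two_ne_zero pi_ne_zero, sum_add_distrib]
  simp_rw [add_comm x, add_comm (1 - x)]
  ring

/-- Partial sums of `∑ (oddHarmonic (n * k + ν) + oddHarmonic (n * k + (n - ν)))`, with opposite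
sign and renormalized so as to converge. -/
noncomputable def oddHarmonicDefect (n ν K : ℕ) : ℝ :=
  2 * K * log n + 2 * log K.factorial - log K - log (2 * π)
    - ∑ k ∈ range K, (oddHarmonic (n * k + ν) + oddHarmonic (n * k + (n - ν)))

theorem summable_midTail {n ν : ℕ} (hν : 1 ≤ ν) (hn : 1 ≤ n) :
    Summable fun k : ℕ => midTail (n * k + ν) := by
  rw [← summable_nat_add_iff 1]
  have hs : Summable fun k : ℕ => midCoeff 0 * (1 / ((k + 1 : ℕ) : ℝ) ^ 2) :=
    ((summable_nat_add_iff 1).2 (Real.summable_one_div_nat_pow.2 one_lt_two)).mul_left _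
  have hc : 0 < midCoeff 0 := by norm_num [midCoeff]
  refine Summable.of_nonneg_of_le (fun k => (midTail_pos (by omega)).le) (fun k => ?_) hs
  refine (midTail_le (by omega)).trans ?_
  rw [mul_one_div]
  have : k + 1 ≤ n * (k + 1) + ν := by nlinarith
  gcongr

theorem tendsto_oddHarmonicDefect {n ν : ℕ} (hν : 1 ≤ ν) (hνn : ν < n) :
    Tendsto (oddHarmonicDefect n ν) atTop (𝓝 (-log (2 * sin (π * (ν / n)))
      - ∑' k, (midTail (n * k + ν) + midTail (n * k + (n - ν))))) := by
  have hn0 : (0 : ℝ) < n := by exact_mod_cast (by omega : 0 < n)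
  have hν0 : (0 : ℝ) < ν := by exact_mod_cast hν
  have hν1 : (ν : ℝ) < n := by exact_mod_cast hνn
  have h1 := tendsto_log_factorial_sub_sum_log (x := ν / n) (by positivity)
    (by rwa [div_lt_one hn0])
  have h2 := ((summable_midTail hν (n := n) (by omega)).add (summable_midTail
    (ν := n - ν) (n := n) (by omega) (by omega))).hasSum.tendsto_sum_nat
  refine (h1.sub h2).congr fun K => ?_
  have hsum : ∑ k ∈ range K, (oddHarmonic (n * k + ν) + oddHarmonic (n * k + (n - ν)))
      = ∑ k ∈ range K, (log (k + ν / n) + log (k + (1 - ν / n)))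
        + ∑ k ∈ range K, (midTail (n * k + ν) + midTail (n * k + (n - ν)))
        + 2 * K * log n := by
    have hc : 2 * (K : ℝ) * log n = ∑ k ∈ range K, 2 * log n := by
      rw [sum_const, card_range, nsmul_eq_mul]
      ring
    rw [hc, ← sum_add_distrib, ← sum_add_distrib]
    refine sum_congr rfl fun k _ => ?_
    have hr : 0 < 1 - (ν : ℝ) / n := by rw [sub_pos, div_lt_one hn0]; exact hν1
    rw [oddHarmonic_eq (by omega), oddHarmonic_eq (by omega)]
    push_cast [Nat.cast_sub hνn.le]
    rw [show (n : ℝ) * k + ν = n * (k + ν / n) by field_simp,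
      show (n : ℝ) * k + (n - ν) = n * (k + (1 - ν / n)) by field_simp,
      log_mul hn0.ne' (by positivity), log_mul hn0.ne' (by positivity)]
    ring
  rw [oddHarmonicDefect, hsum]
  ring

theorem tendsto_oddHarmonicDefect_succ_sub {n ν : ℕ} (hν : ν < n) :
    Tendsto (fun K => oddHarmonicDefect n (ν + 1) K - oddHarmonicDefect n ν K) atTop
      (𝓝 (-(π / n * (cos (π * ((ν + 1 / 2) / n)) / sin (π * ((ν + 1 / 2) / n)))))) := by
  have hn0 : (0 : ℝ) < n := by exact_mod_cast (by omega : 0 < n)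
  have hν1 : (ν : ℝ) + 1 ≤ n := by exact_mod_cast hν
  have hy1 : ((ν : ℝ) + 1 / 2) / n < 1 := by rw [div_lt_one hn0]; linarith
  have h := (tendsto_sum_one_div_sub_one_div (y := (ν + 1 / 2) / n) (by positivity) hy1).const_mul
    (-(1 / (n : ℝ)))
  convert! h using 1
  · ext K
    rw [oddHarmonicDefect, oddHarmonicDefect, sub_sub_sub_cancel_left, ← sum_sub_distrib, mul_sum]
    refine sum_congr rfl fun k _ => ?_
    have e1 := oddHarmonic_succ (n * k + ν)
    have e2 := oddHarmonic_succ (n * k + (n - (ν + 1)))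
    rw [show n * k + (n - (ν + 1)) + 1 = n * k + (n - ν) by omega] at e2
    rw [← add_assoc, e1, e2]
    push_cast [Nat.cast_sub (show ν + 1 ≤ n from hν)]
    have r1 : 1 / ((n : ℝ) * k + ν + 1 / 2) = 1 / n * (1 / (k + (ν + 1 / 2) / n)) := by
      rw [one_div_mul_one_div, mul_add, mul_div_cancel₀ _ hn0.ne', add_assoc]
    have r2 : 1 / ((n : ℝ) * k + (n - (ν + 1)) + 1 / 2)
        = 1 / n * (1 / (k + 1 - (ν + 1 / 2) / n)) := by
      rw [one_div_mul_one_div, mul_sub, mul_div_cancel₀ _ hn0.ne']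
      congr 1
      ring
    rw [r1, r2]
    ring
  · congr 1
    ring

theorem sum_range_mul (f : ℕ → ℝ) (n K : ℕ) :
    ∑ m ∈ range (n * K), f m = ∑ k ∈ range K, ∑ ν ∈ range n, f (n * k + ν) := by
  induction K with
  | zero => simp
  | succ K ih => rw [mul_add_one, sum_range_add, ih, sum_range_succ]

theorem sum_oddHarmonicDefect (n K : ℕ) :
    ∑ ν ∈ range n, oddHarmonicDefect n ν K
      = n * (2 * K * log n + 2 * log K.factorial - log K - log (2 * π))
        - 2 * (n * K) * (oddHarmonic (n * K) - 1) := by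
  have h := sum_oddHarmonic (n * K)
  rw [sum_range_mul, sum_range_mul (fun m => oddHarmonic (m + 1)), ← sum_add_distrib] at h
  push_cast at h
  unfold oddHarmonicDefect
  rw [sum_sub_distrib, sum_const, card_range, nsmul_eq_mul, sum_comm, ← h]
  congr 1
  refine sum_congr rfl fun k _ => ?_
  rw [sum_add_distrib]
  congr 1
  rw [← sum_range_reflect]
  refine sum_congr rfl fun ν hν => ?_
  rw [mem_range] at hν
  congr 1
  omega

theorem tendsto_sum_oddHarmonicDefect {n : ℕ} (hn : 1 ≤ n) :
    Tendsto (fun K => ∑ ν ∈ range n, oddHarmonicDefect n ν K) atTop (𝓝 0) := by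
  have hn0 : (0 : ℝ) < n := by exact_mod_cast hn
  have h1 := tendsto_log_factorial_sub.const_mul (n : ℝ)
  have h2 := (tendsto_mul_midTail.comp (tendsto_id.const_mul_atTop' hn)).const_mul 2
  have h := h1.sub h2
  simp only [mul_zero, sub_zero] at h
  refine h.congr' ?_
  filter_upwards [eventually_ge_atTop 1] with K hK
  have hK0 : (0 : ℝ) < K := by exact_mod_cast hK
  rw [sum_oddHarmonicDefect, oddHarmonic_eq (by nlinarith), Function.comp_apply]
  simp only [id]
  push_cast
  rw [log_mul hn0.ne' hK0.ne']
  ring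

theorem tendsto_zero_of_tendsto_succ_sub {n : ℕ} (hn : 0 < n) {w : ℕ → ℕ → ℝ}
    (hd : ∀ ν, ν + 1 < n → Tendsto (fun K => w (ν + 1) K - w ν K) atTop (𝓝 0))
    (hs : Tendsto (fun K => ∑ ν ∈ range n, w ν K) atTop (𝓝 0)) {ν : ℕ} (hν : ν < n) :
    Tendsto (w ν) atTop (𝓝 0) := by
  have h0 : ∀ ν, ν < n → Tendsto (fun K => w ν K - w 0 K) atTop (𝓝 0) := by
    intro ν
    induction ν with
    | zero => simp
    | succ ν ih =>
      intro hν
      have h := (hd ν hν).add (ih (by omega))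
      simpa using h
  have hn0 : (n : ℝ) ≠ 0 := by exact_mod_cast hn.ne'
  have hsum : Tendsto (fun K => ∑ ν ∈ range n, (w ν K - w 0 K)) atTop (𝓝 0) := by
    simpa using tendsto_finsetSum (range n) fun ν hν => h0 ν (mem_range.1 hν)
  have hw0 : Tendsto (w 0) atTop (𝓝 0) := by
    have h := (hs.sub hsum).const_mul (1 / (n : ℝ))
    simp only [sub_zero, mul_zero, sum_sub_distrib, sum_const, card_range, nsmul_eq_mul,
      sub_sub_cancel] at h
    refine h.congr fun K => ?_
    field_simp
  simpa using (h0 ν hν).add hw0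

theorem pi_div_mul_C_eq {n ν : ℕ} (hν : 1 ≤ ν) (hνn : ν < n) :
    π / n * C n (ν : ℤ) = -2 * log (2 * sin (π * (ν / n)))
      - 2 * ∑' k, (midTail (n * k + ν) + midTail (n * k + (n - ν))) := by
  have hn : 2 ≤ n := by omega
  have h : Tendsto (fun K => oddHarmonicDefect n ν K - π / (2 * n) * C n (ν : ℤ)) atTop (𝓝 0) := by
    refine tendsto_zero_of_tendsto_succ_sub (n := n) (by omega)
      (w := fun ν K => oddHarmonicDefect n ν K - π / (2 * n) * C n (ν : ℤ)) (fun ν hν => ?_) ?_ hνn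
    · have hc := C_succ_sub_C hn (show ν < n by omega)
      have h := (tendsto_oddHarmonicDefect_succ_sub (show ν < n by omega)).sub_const
        (π / (2 * n) * (C n ((ν + 1 : ℕ) : ℤ) - C n (ν : ℤ)))
      convert! h using 1
      · ext K
        ring
      · rw [hc]
        congr 1
        ring
    · simp_rw [sum_sub_distrib, ← mul_sum, sum_C_eq_zero hn, mul_zero, sub_zero]
      exact tendsto_sum_oddHarmonicDefect (by omega)
  have h2 := tendsto_nhds_unique h
    ((tendsto_oddHarmonicDefect hν hνn).sub_const (π / (2 * n) * C n (ν : ℤ)))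
  rw [show π / n * C n (ν : ℤ) = 2 * (π / (2 * n) * C n (ν : ℤ)) by ring]
  linarith

/-- `∑ (1 / (k + x) ^ p + 1 / (k + 1 - x) ^ p)`. -/
noncomputable def reflectedZeta (p : ℕ) (x : ℝ) : ℝ :=
  ∑' k : ℕ, (1 / ((k : ℝ) + x) ^ p + 1 / ((k : ℝ) + (1 - x)) ^ p)

theorem summable_one_div_add_pow {p : ℕ} (hp : 2 ≤ p) {x : ℝ} (hx : 0 < x) :
    Summable fun k : ℕ => 1 / ((k : ℝ) + x) ^ p := by
  rw [← summable_nat_add_iff 1]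
  have hs : Summable fun k : ℕ => 1 / ((k + 1 : ℕ) : ℝ) ^ p :=
    (summable_nat_add_iff 1).2 (Real.summable_one_div_nat_pow.2 (by omega))
  refine Summable.of_nonneg_of_le (fun k => by positivity) (fun k => ?_) hs
  gcongr
  linarith

theorem summable_reflectedZeta {p : ℕ} (hp : 2 ≤ p) {x : ℝ} (h0 : 0 < x) (h1 : x < 1) :
    Summable fun k : ℕ => 1 / ((k : ℝ) + x) ^ p + 1 / ((k : ℝ) + (1 - x)) ^ p :=
  (summable_one_div_add_pow hp h0).add (summable_one_div_add_pow hp (by linarith))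

theorem reflectedZeta_pos {p : ℕ} (hp : 2 ≤ p) {x : ℝ} (h0 : 0 < x) (h1 : x < 1) :
    0 < reflectedZeta p x := by
  have h2 : 0 < 1 - x := by linarith
  exact (summable_reflectedZeta hp h0 h1).tsum_pos (fun k => by positivity) 0 (by positivity)

theorem tsum_midTailError {n ν : ℕ} (hν : 1 ≤ ν) (hνn : ν < n) (M : ℕ) :
    Summable (fun k => midTailError M (n * k + ν) + midTailError M (n * k + (n - ν))) ∧
    ∑' k, (midTailError M (n * k + ν) + midTailError M (n * k + (n - ν)))
      = ∑' k, (midTail (n * k + ν) + midTail (n * k + (n - ν)))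
        - ∑ r ∈ range M, midCoeff r / n ^ (2 * r + 2) * reflectedZeta (2 * r + 2) (ν / n) := by
  have hn0 : (0 : ℝ) < n := by exact_mod_cast (by omega : 0 < n)
  have hν0 : (0 : ℝ) < ν := by exact_mod_cast hν
  have hx1 : (ν : ℝ) / n < 1 := by rw [div_lt_one hn0]; exact_mod_cast hνn
  have hs := (summable_midTail hν (n := n) (by omega)).add (summable_midTail
    (ν := n - ν) (n := n) (by omega) (by omega))
  have hz (r : ℕ) := (summable_reflectedZeta (p := 2 * r + 2) (by omega)
    (show 0 < (ν : ℝ) / n by positivity) hx1).hasSum.mul_left (midCoeff r / n ^ (2 * r + 2))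
  have h := hs.hasSum.sub (hasSum_sum fun r (_ : r ∈ range M) => hz r)
  have e : (fun k => midTailError M (n * k + ν) + midTailError M (n * k + (n - ν)))
      = fun k : ℕ => midTail (n * k + ν) + midTail (n * k + (n - ν))
        - ∑ r ∈ range M, midCoeff r / n ^ (2 * r + 2)
          * (1 / ((k : ℝ) + ν / n) ^ (2 * r + 2) + 1 / ((k : ℝ) + (1 - ν / n)) ^ (2 * r + 2)) := by
    ext k
    have e1 (r : ℕ) : midCoeff r / ((n * k + ν : ℕ) : ℝ) ^ (2 * r + 2)
        = midCoeff r / n ^ (2 * r + 2) * (1 / ((k : ℝ) + ν / n) ^ (2 * r + 2)) := by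
      rw [div_mul_div_comm, ← mul_pow, mul_one]
      congr 2
      push_cast
      field_simp
    have e2 (r : ℕ) : midCoeff r / ((n * k + (n - ν) : ℕ) : ℝ) ^ (2 * r + 2)
        = midCoeff r / n ^ (2 * r + 2) * (1 / ((k : ℝ) + (1 - ν / n)) ^ (2 * r + 2)) := by
      rw [div_mul_div_comm, ← mul_pow, mul_one]
      congr 2
      push_cast [Nat.cast_sub hνn.le]
      field_simp
    simp_rw [midTailError, e1, e2, mul_add, sum_add_distrib]
    ring
  rw [e]
  exact ⟨h.summable, h.tsum_eq⟩

/-- The error of the expansion of `π / n * C n ν` with `M` correction terms. -/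
noncomputable def cosecError (n ν M : ℕ) : ℝ :=
  π / n * C n (ν : ℤ) + 2 * log (2 * sin (π * (ν / n)))
    + 2 * ∑ r ∈ range M, midCoeff r / n ^ (2 * r + 2) * reflectedZeta (2 * r + 2) (ν / n)

theorem cosecError_sign {n ν : ℕ} (hν : 1 ≤ ν) (hνn : ν < n) (M : ℕ) :
    (-1) ^ M * cosecError n ν M < 0 := by
  obtain ⟨hs, he⟩ := tsum_midTailError hν hνn M
  have hp : ∀ k, 0 < (-1) ^ M * (midTailError M (n * k + ν) + midTailError M (n * k + (n - ν))) := by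
    intro k
    rw [mul_add]
    exact add_pos (midTailError_sign M (by omega)) (midTailError_sign M (by omega))
  have hpos := (hs.mul_left ((-1) ^ M)).tsum_pos (fun k => (hp k).le) 0 (hp 0)
  rw [tsum_mul_left, he] at hpos
  rw [cosecError, pi_div_mul_C_eq hν hνn]
  linarith

theorem cosecError_succ (n ν M : ℕ) :
    cosecError n ν (M + 1) = cosecError n ν M
      + 2 * (midCoeff M / n ^ (2 * M + 2) * reflectedZeta (2 * M + 2) (ν / n)) := by
  rw [cosecError, cosecError, sum_range_succ]
  ring

theorem exists_cosecError_eq {n ν : ℕ} (hν : 1 ≤ ν) (hνn : ν < n) (M : ℕ) :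
    ∃ lam : ℝ, 0 < lam ∧ lam < 1 ∧ cosecError n ν M
      = -lam * (2 * (midCoeff M / n ^ (2 * M + 2) * reflectedZeta (2 * M + 2) (ν / n))) := by
  have h1 := cosecError_sign hν hνn M
  have h2 := cosecError_sign hν hνn (M + 1)
  have hs := cosecError_succ n ν M
  set a := cosecError n ν M
  set b := cosecError n ν (M + 1)
  have hq : 0 < a / (a - b) ∧ a / (a - b) < 1 ∧ a - b ≠ 0 := by
    rcases neg_one_pow_eq_or ℝ M with h | h
    · rw [h] at h1
      rw [pow_succ, h] at h2
      refine ⟨div_pos_of_neg_of_neg (by linarith) (by linarith), ?_, by linarith⟩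
      rw [div_lt_one_of_neg (by linarith)]
      linarith
    · rw [h] at h1
      rw [pow_succ, h] at h2
      refine ⟨div_pos (by linarith) (by linarith), ?_, by linarith⟩
      rw [div_lt_one (by linarith)]
      linarith
  refine ⟨a / (a - b), hq.1, hq.2.1, ?_⟩
  have : 2 * (midCoeff M / n ^ (2 * M + 2) * reflectedZeta (2 * M + 2) (ν / n)) = b - a := by
    linarith
  rw [this]
  have := hq.2.2
  field_simp
  ring

/-- The terms of the partial fraction expansion of the derivatives of `π * cot (π * x)`. -/
noncomputable def cotDerivTerm (p k : ℕ) (x : ℝ) : ℝ :=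
  1 / ((k : ℝ) + x) ^ p + (-1) ^ p * (1 / ((k : ℝ) + (1 - x)) ^ p)

theorem hasDerivAt_cotDerivTerm (p k : ℕ) {x : ℝ} (h0 : 0 < x) (h1 : x < 1) :
    HasDerivAt (cotDerivTerm p k) (-p * cotDerivTerm (p + 1) k x) x := by
  have e1 := hasDerivAt_one_div_pow p k (x := x) (by positivity)
  have h2 : 0 < 1 - x + k := by
    have := sub_pos.2 h1
    positivity
  have e2 := ((hasDerivAt_one_div_pow p k (x := 1 - x) h2.ne').comp x
    ((hasDerivAt_id x).const_sub 1)).const_mul ((-1) ^ p)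
  convert! e1.add e2 using 1
  · ext y
    simp [cotDerivTerm, add_comm]
  · simp only [cotDerivTerm, add_comm (k : ℝ)]
    ring

theorem abs_cotDerivTerm_le (p k : ℕ) {ε x : ℝ} (hε : 0 < ε) (h0 : ε < x) (h1 : x < 1 - ε) :
    |cotDerivTerm p k x| ≤ 2 * (1 / ((k : ℝ) + ε) ^ p) := by
  have hx : 0 < x := by linarith
  have hx1 : ε < 1 - x := by linarith
  have hx2 : 0 < 1 - x := by linarith
  have h2 : 1 / ((k : ℝ) + x) ^ p ≤ 1 / ((k : ℝ) + ε) ^ p := by gcongr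
  have h3 : 1 / ((k : ℝ) + (1 - x)) ^ p ≤ 1 / ((k : ℝ) + ε) ^ p := by gcongr
  refine (abs_add_le _ _).trans ?_
  rw [abs_mul, abs_pow, abs_neg, abs_one, one_pow, one_mul, abs_of_pos (by positivity),
    abs_of_pos (by positivity)]
  linarith

theorem hasDerivAt_tsum_cotDerivTerm {p : ℕ} (hp : 1 ≤ p) {x : ℝ} (h0 : 0 < x) (h1 : x < 1) :
    Summable (fun k => cotDerivTerm p k x) ∧
    HasDerivAt (fun x => ∑' k, cotDerivTerm p k x) (-p * ∑' k, cotDerivTerm (p + 1) k x) x := by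
  obtain ⟨ε, hε, hε'⟩ : ∃ ε, 0 < ε ∧ ε < min (1 / 2) (min x (1 - x)) :=
    exists_between (lt_min (by norm_num) (lt_min h0 (sub_pos.2 h1)))
  simp only [lt_min_iff] at hε'
  have hu : Summable fun k : ℕ => (p : ℝ) * (2 * (1 / ((k : ℝ) + ε) ^ (p + 1))) :=
    ((summable_one_div_add_pow (by omega) hε).mul_left 2).mul_left _
  have hd : ∀ (k : ℕ) (y : ℝ), y ∈ Set.Ioo ε (1 - ε) →
      HasDerivAt (cotDerivTerm p k) (-p * cotDerivTerm (p + 1) k y) y :=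
    fun k y hy => hasDerivAt_cotDerivTerm p k (hε.trans hy.1) (by linarith [hy.2])
  have hb : ∀ (k : ℕ) (y : ℝ), y ∈ Set.Ioo ε (1 - ε) →
      ‖-p * cotDerivTerm (p + 1) k y‖ ≤ (p : ℝ) * (2 * (1 / ((k : ℝ) + ε) ^ (p + 1))) := by
    intro k y hy
    rw [norm_mul, norm_neg, norm_natCast, norm_eq_abs]
    gcongr
    exact abs_cotDerivTerm_le _ _ hε hy.1 hy.2
  have hhalf : (1 / 2 : ℝ) ∈ Set.Ioo ε (1 - ε) := ⟨hε'.1, by linarith [hε'.1]⟩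
  have hx : x ∈ Set.Ioo ε (1 - ε) := ⟨hε'.2.1, by linarith [hε'.2.2]⟩
  have hs : Summable fun k => cotDerivTerm p k (1 / 2) := by
    rcases hp.eq_or_lt with rfl | hp
    · refine summable_zero.congr fun k => ?_
      norm_num [cotDerivTerm]
    · exact (summable_one_div_add_pow hp (by norm_num)).add
        ((summable_one_div_add_pow hp (by norm_num)).mul_left _)
  refine ⟨summable_of_summable_hasDerivAt_of_isPreconnected hu isOpen_Ioo isPreconnected_Ioo
    hd hb hhalf hs hx, ?_⟩
  rw [← tsum_mul_left]
  exact hasDerivAt_tsum_of_isPreconnected hu isOpen_Ioo isPreconnected_Ioo hd hb hhalf hs hx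

theorem pi_mul_cot_eq_tsum {x : ℝ} (h0 : 0 < x) (h1 : x < 1) :
    π * (cos (π * x) / sin (π * x)) = ∑' k, cotDerivTerm 1 k x := by
  refine tendsto_nhds_unique (tendsto_sum_one_div_sub_one_div h0 h1) ?_
  refine (hasDerivAt_tsum_cotDerivTerm le_rfl h0 h1).1.hasSum.tendsto_sum_nat.congr fun K => ?_
  refine sum_congr rfl fun k _ => ?_
  rw [cotDerivTerm]
  ring

theorem iteratedDeriv_tsum_cotDerivTerm (m : ℕ) {x : ℝ} (hx : x ∈ Set.Ioo (0 : ℝ) 1) :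
    iteratedDeriv m (fun x => ∑' k, cotDerivTerm 1 k x) x
      = (-1) ^ m * m.factorial * ∑' k, cotDerivTerm (m + 1) k x := by
  induction m generalizing x with
  | zero => simp
  | succ m ih =>
    have he : iteratedDeriv m (fun x => ∑' k, cotDerivTerm 1 k x) =ᶠ[𝓝 x]
        fun x => (-1) ^ m * m.factorial * ∑' k, cotDerivTerm (m + 1) k x := by
      filter_upwards [isOpen_Ioo.mem_nhds hx] with y hy using ih hy
    rw [iteratedDeriv_succ, he.deriv_eq,
      ((hasDerivAt_tsum_cotDerivTerm (show 1 ≤ m + 1 by omega) hx.1 hx.2).2.const_mul _).deriv,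
      Nat.factorial_succ]
    push_cast
    ring

theorem analyticAt_Gamma_of_pos {x : ℝ} (hx : 0 < x) : AnalyticAt ℝ Gamma x := by
  have hd : DifferentiableOn ℂ Complex.Gamma {z : ℂ | 0 < z.re} := fun z hz =>
    (Complex.differentiableAt_Gamma z fun m hm => by
      rw [hm] at hz
      have h : (0 : ℝ) < -m := by simpa using hz
      have : (0 : ℝ) ≤ m := m.cast_nonneg
      linarith).differentiableWithinAt
  have ha : AnalyticAt ℂ Complex.Gamma (x : ℂ) :=
    hd.analyticAt ((isOpen_lt continuous_const Complex.continuous_re).mem_nhds (by simpa using hx))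
  exact (Complex.reCLM.analyticAt _).comp
    ((ha.restrictScalars (𝕜 := ℝ)).comp (Complex.ofRealCLM.analyticAt x))

theorem contDiffAt_digamma {x : ℝ} (hx : 0 < x) (m : ℕ) : ContDiffAt ℝ m digamma x :=
  ((analyticAt_Gamma_of_pos hx).deriv.div (analyticAt_Gamma_of_pos hx)
    (Gamma_pos_of_pos hx).ne').contDiffAt

theorem digamma_sub_digamma_one_sub {x : ℝ} (h0 : 0 < x) (h1 : x < 1) :
    digamma x - digamma (1 - x) = -(π * (cos (π * x) / sin (π * x))) := by
  have hs : 0 < sin (π * x) := sin_pos_of_pos_of_lt_pi (by positivity) (by nlinarith [pi_pos])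
  have g0 := Gamma_pos_of_pos h0
  have g1 := Gamma_pos_of_pos (sub_pos.2 h1)
  have d0 := (analyticAt_Gamma_of_pos h0).differentiableAt.hasDerivAt
  have d1 := (analyticAt_Gamma_of_pos (sub_pos.2 h1)).differentiableAt.hasDerivAt.comp x
    ((hasDerivAt_id x).const_sub 1)
  have d2 := (((hasDerivAt_id x).const_mul π).sin.inv hs.ne').const_mul π
  have hd := d0.mul d1
  have he : (Gamma * (Gamma ∘ fun x => 1 - id x)) = fun x => π * (sin (π * id x))⁻¹ := by
    ext y
    exact Gamma_mul_Gamma_one_sub y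
  have h := (he ▸ hd).unique d2
  have hr := Gamma_mul_Gamma_one_sub x
  simp only [id, Function.comp_apply, mul_one] at h
  rw [digamma, digamma, div_sub_div _ _ g0.ne' g1.ne', hr, div_eq_iff (div_pos pi_pos hs).ne']
  linear_combination h

theorem polygamma_add_polygamma_one_sub {m : ℕ} (hm : Odd m) {x : ℝ} (h0 : 0 < x) (h1 : x < 1) :
    polygamma m x + polygamma m (1 - x) = m.factorial * reflectedZeta (m + 1) x := by
  have hx : x ∈ Set.Ioo (0 : ℝ) 1 := ⟨h0, h1⟩
  have hc : ContDiffAt ℝ m (fun y => digamma (1 - y)) x :=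
    (contDiffAt_digamma (sub_pos.2 h1) m).comp x (contDiffAt_const.sub contDiffAt_id)
  have hsub := iteratedDeriv_fun_sub (contDiffAt_digamma h0 m) hc
  have he : (fun y => digamma y - digamma (1 - y)) =ᶠ[𝓝 x]
      fun y => -∑' k, cotDerivTerm 1 k y := by
    filter_upwards [isOpen_Ioo.mem_nhds hx] with y hy
    rw [digamma_sub_digamma_one_sub hy.1 hy.2, pi_mul_cot_eq_tsum hy.1 hy.2]
  rw [(he.iteratedDeriv m).eq_of_nhds, iteratedDeriv_fun_neg, iteratedDeriv_tsum_cotDerivTerm m hx,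
    iteratedDeriv_comp_const_sub, hm.neg_one_pow] at hsub
  have hz : ∑' k, cotDerivTerm (m + 1) k x = reflectedZeta (m + 1) x := by
    simp only [cotDerivTerm, reflectedZeta, hm.add_one.neg_one_pow, one_mul]
  rw [hz] at hsub
  simp only [polygamma]
  simp at hsub
  linarith

theorem Hcal_eq {r : ℕ} (hr : 1 ≤ r) {x : ℝ} (h0 : 0 < x) (h1 : x < 1) :
    Hcal r x = -((2 * r - 1).factorial * reflectedZeta (2 * r) x) / π ^ (2 * r) := by
  have hodd : Odd (2 * r - 1) := ⟨r - 1, by omega⟩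
  rw [Hcal, polygamma_add_polygamma_one_sub hodd h0 h1, Nat.sub_add_cancel (by omega)]

theorem Hcal_neg {r : ℕ} (hr : 1 ≤ r) {x : ℝ} (h0 : 0 < x) (h1 : x < 1) : Hcal r x < 0 := by
  have := reflectedZeta_pos (p := 2 * r) (by omega) h0 h1
  rw [Hcal_eq hr h0 h1, neg_div]
  exact neg_neg_of_pos (by positivity)

theorem bernoulli_mul_Hcal_eq (n r : ℕ) (hn : 1 ≤ n) {x : ℝ} (h0 : 0 < x) (h1 : x < 1) :
    (1 - (2 : ℝ) ^ ((1 : ℤ) - 2 * ((r + 1 : ℕ) : ℤ))) * π ^ (2 * (r + 1) - 1)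
        * (bernoulli (2 * (r + 1)) : ℝ) * Hcal (r + 1) x
        / (((2 * (r + 1)).factorial : ℝ) * (n : ℝ) ^ (2 * (r + 1) - 1))
      = -(n / π * (midCoeff r / n ^ (2 * r + 2) * reflectedZeta (2 * r + 2) x)) := by
  have hn0 : (0 : ℝ) < n := by exact_mod_cast hn
  have hpow : (2 : ℝ) ^ ((1 : ℤ) - 2 * ((r + 1 : ℕ) : ℤ)) = 2 / 4 ^ (r + 1) := by
    rw [zpow_sub₀ two_ne_zero, zpow_one, zpow_mul, zpow_natCast]
    norm_num
  rw [Hcal_eq (by omega) h0 h1, hpow, show 2 * (r + 1) - 1 = 2 * r + 1 by omega,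
    show 2 * (r + 1) = 2 * r + 1 + 1 by ring, Nat.factorial_succ (2 * r + 1), midCoeff]
  push_cast
  field_simp
  ring

end

theorem C_asymptotic_expansion (n : ℕ) (hn : 2 ≤ n) (ν : ℕ) (hν1 : 1 ≤ ν) (hν2 : ν ≤ n - 1)
    (N : ℕ) (hN : 2 ≤ N) :
    (∃ lam : ℝ, 0 < lam ∧ lam < 1 ∧
      C n (ν : ℤ)
        = -(2 * n / π) * Real.log (2 * Real.sin (π * ν / n))
          + 2 * ∑ r ∈ Finset.Icc 1 (N - 1),
              (1 - (2 : ℝ) ^ ((1 : ℤ) - 2 * r)) * π ^ (2 * r - 1) * (bernoulli (2 * r) : ℝ)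
                * Hcal r ((ν : ℝ) / n) / ((Nat.factorial (2 * r) : ℝ) * (n : ℝ) ^ (2 * r - 1))
          + 2 * lam * (1 - (2 : ℝ) ^ ((1 : ℤ) - 2 * N)) * π ^ (2 * N - 1)
              * (bernoulli (2 * N) : ℝ) * Hcal N ((ν : ℝ) / n)
              / ((Nat.factorial (2 * N) : ℝ) * (n : ℝ) ^ (2 * N - 1))) ∧
    ∀ r : ℕ, 1 ≤ r → Hcal r ((ν : ℝ) / n) < 0 := by
  have hn0 : (0 : ℝ) < n := by exact_mod_cast (by omega : 0 < n)
  have hν0 : (0 : ℝ) < ν := by exact_mod_cast hν1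
  have hνn : ν < n := by omega
  have h0 : 0 < (ν : ℝ) / n := by positivity
  have h1 : (ν : ℝ) / n < 1 := by rw [div_lt_one hn0]; exact_mod_cast hνn
  refine ⟨?_, fun r hr => Hcal_neg hr h0 h1⟩
  obtain ⟨M, rfl⟩ : ∃ M, N = M + 1 := ⟨N - 1, by omega⟩
  obtain ⟨lam, hl0, hl1, hl⟩ := exists_cosecError_eq hν1 hνn M
  refine ⟨lam, hl0, hl1, ?_⟩
  have hterm (r : ℕ) := bernoulli_mul_Hcal_eq n r (by omega) h0 h1
  have hC : C n (ν : ℤ) = -(2 * n / π) * log (2 * sin (π * (ν / n)))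
      + 2 * ∑ r ∈ range M, -(n / π * (midCoeff r / n ^ (2 * r + 2)
          * reflectedZeta (2 * r + 2) (ν / n)))
      + 2 * lam * -(n / π * (midCoeff M / n ^ (2 * M + 2)
          * reflectedZeta (2 * M + 2) (ν / n))) := by
    have hπ : n / π * (π / n) = 1 := by field_simp
    rw [cosecError] at hl
    rw [sum_neg_distrib, ← mul_sum]
    linear_combination (n / π) * hl - C n (ν : ℤ) * hπ
  rw [hC, Nat.add_sub_cancel, show Finset.Icc 1 M = Finset.Ico (0 + 1) (M + 1) from rfl,
    ← sum_Ico_add', ← range_eq_Ico]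
  simp_rw [← hterm]
  rw [mul_div_assoc π]
  ring
end

section
/- For every integer n ≥ 2 and every integer ν with 1 ≤ ν ≤ n − 1, one has −(2n/π)·ln(2·sin(πν/n)) − (π/(12n))·csc²(πν/n) < C_n(ν) < −(2n/π)·ln(2·sin(πν/n)) − (π/(12n))·csc²(πν/n) + (7π³/(1440·n³))·(1 + 2·cos²(πν/n))·csc⁴(πν/n). Moreover, for every even integer n ≥ 2, 2n·ln 2/π + π/(12n) − 7π³/(1440·n³) < Σ_{l=1}^{n−1} (−1)^{l+1}·csc(πl/n) < 2n·ln 2/π + π/(12n). -/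
open Real Finset

theorem nonneg_of_hasDerivAt_nonneg {f f' : ℝ → ℝ} {b : ℝ} (h0 : f 0 = 0)
    (hf : ∀ x, 0 ≤ x → x < b → HasDerivAt f (f' x) x)
    (hf' : ∀ x, 0 < x → x < b → 0 ≤ f' x) {x : ℝ} (hx : 0 ≤ x) (hxb : x < b) : 0 ≤ f x := by
  have hmono : MonotoneOn f (Set.Icc 0 x) := by
    apply monotoneOn_of_hasDerivWithinAt_nonneg (f' := f') (convex_Icc 0 x)
    · intro y hy
      exact (hf y hy.1 (hy.2.trans_lt hxb)).continuousAt.continuousWithinAt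
    · intro y hy
      rw [interior_Icc] at hy
      exact (hf y hy.1.le (hy.2.trans hxb)).hasDerivWithinAt
    · intro y hy
      rw [interior_Icc] at hy
      exact hf' y hy.1 (hy.2.trans hxb)
  have := hmono (Set.left_mem_Icc.2 hx) (Set.right_mem_Icc.2 hx) hx
  rwa [h0] at this

theorem hasDerivAt_log_one_add_sub_log_one_sub {x : ℝ} (h1 : -1 < x) (h2 : x < 1) :
    HasDerivAt (fun u => log (1 + u) - log (1 - u)) (2 / (1 - x ^ 2)) x := by
  have ha : (1 + x) ≠ 0 := by linarith
  have hb : (1 - x) ≠ 0 := by linarith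
  have h := (((hasDerivAt_id x).const_add 1).log ha).sub (((hasDerivAt_id x).const_sub 1).log hb)
  refine h.congr_deriv ?_
  have : (1 - x ^ 2) ≠ 0 := by
    rw [show 1 - x ^ 2 = (1 + x) * (1 - x) by ring]; exact mul_ne_zero ha hb
  change 1 / (1 + x) - -1 / (1 - x) = _
  field_simp
  ring

theorem log_one_add_sub_log_one_sub_le {T : ℝ} (h0 : 0 ≤ T) (h1 : T < 1) :
    log (1 + T) - log (1 - T) ≤ 2 * T + 2 / 3 * (T ^ 3 / (1 - T ^ 2) ^ 2) := by
  rw [← sub_nonneg]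
  refine nonneg_of_hasDerivAt_nonneg (b := 1)
    (f := fun T => 2 * T + 2 / 3 * (T ^ 3 / (1 - T ^ 2) ^ 2) - (log (1 + T) - log (1 - T)))
    (f' := fun u => 2 + 2 / 3 * (3 * u ^ 2 / (1 - u ^ 2) ^ 2 + 4 * u ^ 4 / (1 - u ^ 2) ^ 3)
      - 2 / (1 - u ^ 2)) (by simp) ?_ ?_ h0 h1
  · intro x hx0 hx1
    have hw : (1 - x ^ 2) ≠ 0 := by nlinarith
    have h := (((hasDerivAt_id x).const_mul 2).add
      ((((hasDerivAt_id x).pow 3).div (((((hasDerivAt_id x).pow 2).const_sub 1)).pow 2)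
        (pow_ne_zero 2 hw)).const_mul (2 / 3))).sub
      (hasDerivAt_log_one_add_sub_log_one_sub (by linarith) hx1)
    refine h.congr_deriv ?_
    simp only [id, Pi.pow_apply]
    field_simp
    ring
  · intro u hu0 hu1
    have hw : 0 < 1 - u ^ 2 := by nlinarith
    have : 2 + 2 / 3 * (3 * u ^ 2 / (1 - u ^ 2) ^ 2 + 4 * u ^ 4 / (1 - u ^ 2) ^ 3)
      - 2 / (1 - u ^ 2) = (2 * u ^ 4 * (1 - u ^ 2) + 8 / 3 * u ^ 4) / (1 - u ^ 2) ^ 3 := by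
      field_simp
      ring
    rw [this]
    positivity

theorem le_log_one_add_sub_log_one_sub {T : ℝ} (h0 : 0 ≤ T) (h1 : T < 1) :
    2 * T + 2 / 3 * (T ^ 3 / (1 - T ^ 2) ^ 2) - 14 / 15 * ((T ^ 5 + T ^ 7) / (1 - T ^ 2) ^ 4) ≤
      log (1 + T) - log (1 - T) := by
  rw [← sub_nonneg]
  refine nonneg_of_hasDerivAt_nonneg (b := 1)
    (f := fun T => log (1 + T) - log (1 - T) - (2 * T + 2 / 3 * (T ^ 3 / (1 - T ^ 2) ^ 2)
      - 14 / 15 * ((T ^ 5 + T ^ 7) / (1 - T ^ 2) ^ 4)))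
    (f' := fun u => 2 / (1 - u ^ 2) -
      (2 + 2 / 3 * (3 * u ^ 2 / (1 - u ^ 2) ^ 2 + 4 * u ^ 4 / (1 - u ^ 2) ^ 3)
       - 14 / 15 * ((5 * u ^ 4 + 7 * u ^ 6) / (1 - u ^ 2) ^ 4 +
          8 * (u ^ 6 + u ^ 8) / (1 - u ^ 2) ^ 5))) (by simp) ?_ ?_ h0 h1
  · intro x hx0 hx1
    have hw : (1 - x ^ 2) ≠ 0 := by nlinarith
    have h := (hasDerivAt_log_one_add_sub_log_one_sub (by linarith) hx1).sub
      ((((hasDerivAt_id x).const_mul 2).add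
      ((((hasDerivAt_id x).pow 3).div (((((hasDerivAt_id x).pow 2).const_sub 1)).pow 2)
        (pow_ne_zero 2 hw)).const_mul (2 / 3))).sub
      (((((hasDerivAt_id x).pow 5).add ((hasDerivAt_id x).pow 7)).div
        (((((hasDerivAt_id x).pow 2).const_sub 1)).pow 4) (pow_ne_zero 4 hw)).const_mul (14 / 15)))
    refine h.congr_deriv ?_
    simp only [id, Pi.pow_apply, Pi.add_apply]
    field_simp
    ring
  · intro u hu0 hu1
    have hu : 0 < u ^ 2 := by positivity
    have hw : 0 < 1 - u ^ 2 := by nlinarith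
    have : 2 / (1 - u ^ 2) -
      (2 + 2 / 3 * (3 * u ^ 2 / (1 - u ^ 2) ^ 2 + 4 * u ^ 4 / (1 - u ^ 2) ^ 3)
       - 14 / 15 * ((5 * u ^ 4 + 7 * u ^ 6) / (1 - u ^ 2) ^ 4 +
          8 * (u ^ 6 + u ^ 8) / (1 - u ^ 2) ^ 5)) =
        u ^ 6 * (194 / 15 + 116 / 15 * (1 - u ^ 2) + 2 * (u ^ 2) ^ 2) / (1 - u ^ 2) ^ 5 := by
      field_simp
      ring
    rw [this]
    positivity

theorem hasDerivAt_tan_of_lt {x : ℝ} (h0 : 0 ≤ x) (h1 : x < 1 / 10) :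
    HasDerivAt tan (1 + tan x ^ 2) x := by
  have hc : cos x ≠ 0 :=
    (cos_pos_of_mem_Ioo ⟨by linarith [pi_gt_three], by linarith [pi_gt_three]⟩).ne'
  refine (hasDerivAt_tan hc).congr_deriv ?_
  rw [tan_eq_sin_div_cos]
  field_simp
  rw [← sin_sq_add_cos_sq x]; ring

theorem le_tan_of_deriv_le {p p' : ℝ → ℝ} (h0 : p 0 = 0) (hp : ∀ x, HasDerivAt p (p' x) x)
    (hp' : ∀ x, 0 < x → x < 1 / 10 → p' x ≤ 1 + tan x ^ 2) {x : ℝ} (hx : 0 ≤ x)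
    (hx1 : x < 1 / 10) : p x ≤ tan x := by
  rw [← sub_nonneg]
  exact nonneg_of_hasDerivAt_nonneg (f := fun x => tan x - p x) (by simp [h0])
    (fun y hy hy1 => (hasDerivAt_tan_of_lt hy hy1).sub (hp y))
    (fun y hy hy1 => sub_nonneg.2 (hp' y hy hy1)) hx hx1

theorem tan_le_of_le_deriv {p p' : ℝ → ℝ} (h0 : p 0 = 0) (hp : ∀ x, HasDerivAt p (p' x) x)
    (hp' : ∀ x, 0 < x → x < 1 / 10 → 1 + tan x ^ 2 ≤ p' x) {x : ℝ} (hx : 0 ≤ x)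
    (hx1 : x < 1 / 10) : tan x ≤ p x := by
  rw [← sub_nonneg]
  exact nonneg_of_hasDerivAt_nonneg (f := fun x => p x - tan x) (by simp [h0])
    (fun y hy hy1 => (hp y).sub (hasDerivAt_tan_of_lt hy hy1))
    (fun y hy hy1 => sub_nonneg.2 (hp' y hy hy1)) hx hx1

theorem hasDerivAt_odd_poly (a b c x : ℝ) :
    HasDerivAt (fun x => x + a * x ^ 3 + b * x ^ 5 + c * x ^ 7)
      (1 + 3 * a * x ^ 2 + 5 * b * x ^ 4 + 7 * c * x ^ 6) x := by
  refine ((((hasDerivAt_id x).add ((hasDerivAt_pow 3 x).const_mul a)).add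
    ((hasDerivAt_pow 5 x).const_mul b)).add ((hasDerivAt_pow 7 x).const_mul c)).congr_deriv ?_
  push_cast
  ring

theorem quintic_le_tan {h : ℝ} (h0 : 0 ≤ h) (h1 : h < 1 / 10) :
    h + h ^ 3 / 3 + 2 * h ^ 5 / 15 ≤ tan h := by
  have key : ∀ x : ℝ, 0 ≤ x → x < 1 / 10 → x + 1 / 3 * x ^ 3 + 0 * x ^ 5 + 0 * x ^ 7 ≤ tan x := by
    intro x hx hx1
    refine le_tan_of_deriv_le (by simp) (hasDerivAt_odd_poly _ _ _) ?_ hx hx1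
    intro y hy hy1
    have := pow_le_pow_left₀ hy.le (lt_tan hy (by linarith [pi_gt_three])).le 2
    linarith
  have := le_tan_of_deriv_le (by simp) (hasDerivAt_odd_poly (1 / 3) (2 / 15) 0) (fun y hy hy1 => by
    have := pow_le_pow_left₀ (by positivity) (key y hy.le hy1) 2
    have h6 : 0 ≤ y ^ 6 := by positivity
    nlinarith) h0 h1
  linarith

theorem tan_le_septic {h : ℝ} (h0 : 0 ≤ h) (h1 : h < 1 / 10) :
    tan h ≤ h + h ^ 3 / 3 + 2 * h ^ 5 / 15 + h ^ 7 / 10 := by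
  have key0 : ∀ x : ℝ, 0 ≤ x → x < 1 / 10 → 0 ≤ tan x := fun x hx hx1 =>
    tan_nonneg_of_nonneg_of_le_pi_div_two hx (by linarith [pi_gt_three])
  have key1 : ∀ x : ℝ, 0 ≤ x → x < 1 / 10 → tan x ≤ x + 3 / 5 * x ^ 3 := by
    intro x hx hx1
    have hc := one_sub_sq_div_two_le_cos (x := x)
    have hc0 : 0 < cos x := by nlinarith
    rw [tan_eq_sin_div_cos, div_le_iff₀ hc0]
    have : x ≤ (x + 3 / 5 * x ^ 3) * (1 - x ^ 2 / 2) := by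
      have : 0 ≤ x ^ 3 * (1 / 10 - 3 / 10 * x ^ 2) := mul_nonneg (by positivity) (by nlinarith)
      nlinarith
    exact (sin_le hx).trans (this.trans (mul_le_mul_of_nonneg_left hc (by positivity)))
  have key2 : ∀ x : ℝ, 0 ≤ x → x < 1 / 10 →
      tan x ≤ x + 1 / 3 * x ^ 3 + 13 / 50 * x ^ 5 + 0 * x ^ 7 := by
    intro x hx hx1
    refine tan_le_of_le_deriv (by simp) (hasDerivAt_odd_poly _ _ _) ?_ hx hx1
    intro y hy hy1
    have := pow_le_pow_left₀ (key0 y hy.le hy1) (key1 y hy.le hy1) 2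
    have : 0 ≤ y ^ 4 * (1 / 10 - 9 / 25 * y ^ 2) := mul_nonneg (by positivity) (by nlinarith)
    nlinarith
  have := tan_le_of_le_deriv (by simp) (hasDerivAt_odd_poly (1 / 3) (2 / 15) (1 / 10))
    (fun y hy hy1 => by
    have := pow_le_pow_left₀ (key0 y hy.le hy1) (key2 y hy.le hy1) 2
    have : 0 ≤ y ^ 6 * (7 / 10 - 1 / 9 - 13 / 25 - 13 / 75 * y ^ 2 - (13 / 50) ^ 2 * y ^ 4) :=
      mul_nonneg (by positivity) (by
        have : y ^ 2 ≤ 1 / 100 := by nlinarith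
        nlinarith)
    nlinarith) h0 h1
  linarith

theorem tan_poly_one {h t k : ℝ} (h0 : 0 < h) (h1 : h < 1 / 10) (hlt : h ≤ t)
    (hu : t ≤ h + h ^ 3 / 3 + 2 * h ^ 5 / 15 + h ^ 7 / 10) (hk : k * t < 1) (hk0 : 0 ≤ k) :
    3 * (t - h) * (1 - (k * t) ^ 2) ^ 2 + k ^ 2 * t ^ 3 <
      h ^ 2 * t * ((1 + k ^ 2) * (1 + t ^ 2)) := by
  have ht0 : 0 < t := by linarith
  have hT0 : 0 ≤ k * t := by positivity
  have hx : (k * t) ^ 2 < 1 := by nlinarith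
  have hw : (1 - (k * t) ^ 2) ^ 2 ≤ 1 - (k * t) ^ 2 := by nlinarith [sq_nonneg (k * t)]
  have a1 : 3 * (t - h) < h ^ 2 * t * (1 + t ^ 2) := by
    have : h ^ 2 * h * (1 + h ^ 2) ≤ h ^ 2 * t * (1 + t ^ 2) := by gcongr
    have : 0 < h ^ 5 * (3 / 5 - 3 / 10 * h ^ 2) := mul_pos (by positivity) (by nlinarith)
    nlinarith
  have a2 : 0 ≤ k ^ 2 * t * ((t - h) * (2 * t - h) + h ^ 2 * t ^ 2) := by
    have : 0 ≤ (t - h) * (2 * t - h) := mul_nonneg (by linarith) (by linarith)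
    positivity
  have a3 := mul_le_mul_of_nonneg_left hw (show 0 ≤ 3 * (t - h) by linarith)
  nlinarith

theorem bivariate_poly_pos {y x : ℝ} (y0 : 0 < y) (y1 : y < 1 / 100) (x0 : 0 ≤ x) (x1 : x < 1) :
    0 < 31 / 2 * y ^ 3 + 21 * y ^ 4 + x * (341 / 3 * y ^ 2 + 271 / 3 * y ^ 3 + 119 / 5 * y ^ 4)
      + x ^ 2 * (155 * y + 259 / 5 * y ^ 2 - 46 / 3 * y ^ 3 + 217 / 75 * y ^ 4)
      + x ^ 3 * (-58 * y - 11 / 5 * y ^ 2 + 277 / 15 * y ^ 3 + 7 / 75 * y ^ 4)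
      + x ^ 4 * (15 * y + y ^ 2 - 9 / 2 * y ^ 3) := by
  have hy2 : y ^ 2 ≤ y / 100 := by nlinarith
  have hy3 : y ^ 3 ≤ y / 10000 := by nlinarith
  have h2 : 0 ≤ x ^ 2 * (155 * y + 259 / 5 * y ^ 2 - 46 / 3 * y ^ 3 + 217 / 75 * y ^ 4 - 150 * y) :=
    mul_nonneg (by positivity) (by
      have : 0 ≤ y ^ 4 := by positivity
      nlinarith)
  have h3 : 0 ≤ x ^ 3 * (60 * y + (-58 * y - 11 / 5 * y ^ 2 + 277 / 15 * y ^ 3 + 7 / 75 * y ^ 4)) :=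
    mul_nonneg (by positivity) (by
      have : 0 ≤ y ^ 4 := by positivity
      have : 0 ≤ y ^ 3 := by positivity
      nlinarith)
  have h4 : 0 ≤ x ^ 4 * (15 * y + y ^ 2 - 9 / 2 * y ^ 3) :=
    mul_nonneg (by positivity) (by nlinarith [sq_nonneg y])
  have h5 : 0 ≤ x ^ 2 * y * (1 - x) := mul_nonneg (by positivity) (by linarith)
  have h1 : 0 ≤ x * (341 / 3 * y ^ 2 + 271 / 3 * y ^ 3 + 119 / 5 * y ^ 4) := by positivity
  have h0 : 0 < 31 / 2 * y ^ 3 + 21 * y ^ 4 := by positivity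
  have h6 : 0 ≤ x ^ 2 * y := by positivity
  nlinarith

theorem poly_pos_of_bounds {y x r δ : ℝ} (y0 : 0 < y) (y1 : y < 1 / 100) (x0 : 0 ≤ x) (x1 : x < 1)
    (hr : y / 3 + y ^ 2 / 45 - y ^ 3 / 10 ≤ r)
    (hδ : y + y ^ 2 + (y / 3 + y ^ 2 / 15) * x - y ^ 3 / 10 ≤ δ)
    (hδ' : δ ≤ y + y ^ 2 + (y / 3 + y ^ 2 / 15) * x + 19 / 20 * y ^ 3) :
    0 < 45 * r * (1 - x) ^ 4 - (1 - x) ^ 2 * (15 * δ + 7 * y * (δ + x))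
      + 21 * (1 + x) * δ * (δ + 2 * x) := by
  set δ₀ := y + y ^ 2 + (y / 3 + y ^ 2 / 15) * x with hδ₀
  have hr' := mul_le_mul_of_nonneg_right hr (show 0 ≤ 45 * (1 - x) ^ 4 by positivity)
  have hbound : δ₀ ≤ 1 / 50 := by
    have : (y / 3 + y ^ 2 / 15) * x ≤ y / 3 + y ^ 2 / 15 :=
      mul_le_of_le_one_right (by positivity) x1.le
    nlinarith
  have hδpos : 0 ≤ δ₀ := by positivity
  have hw : (1 - x) ^ 2 ≤ 1 := by nlinarith
  have hw0 : 0 ≤ (1 - x) ^ 2 := by positivity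
  have hx1 : 0 ≤ (1 + x) * (2 * δ₀ + 2 * x) := by positivity
  have hx2 : (1 + x) * (2 * δ₀ + 2 * x) ≤ 5 := by nlinarith
  have hw' : (1 - x) ^ 2 * (15 + 7 * y) ≤ 151 / 10 := by nlinarith
  have hw'' : 0 ≤ (1 - x) ^ 2 * (15 + 7 * y) := by positivity
  have hy3 : 0 < y ^ 3 := by positivity
  have hlin : -15 * y ^ 3 ≤
      (δ - δ₀) * (21 * ((1 + x) * (2 * δ₀ + 2 * x)) - (1 - x) ^ 2 * (15 + 7 * y)) := by
    rcases le_total δ₀ δ with h | h <;> nlinarith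
  have hsq : 0 ≤ 21 * (1 + x) * (δ - δ₀) ^ 2 := by positivity
  have := bivariate_poly_pos y0 y1 x0 x1
  have hexp : (y / 3 + y ^ 2 / 45 - y ^ 3 / 10) * (45 * (1 - x) ^ 4)
      - (1 - x) ^ 2 * (15 * δ₀ + 7 * y * (δ₀ + x)) + 21 * (1 + x) * δ₀ * (δ₀ + 2 * x) - 15 * y ^ 3
      = 31 / 2 * y ^ 3 + 21 * y ^ 4 + x * (341 / 3 * y ^ 2 + 271 / 3 * y ^ 3 + 119 / 5 * y ^ 4)
      + x ^ 2 * (155 * y + 259 / 5 * y ^ 2 - 46 / 3 * y ^ 3 + 217 / 75 * y ^ 4)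
      + x ^ 3 * (-58 * y - 11 / 5 * y ^ 2 + 277 / 15 * y ^ 3 + 7 / 75 * y ^ 4)
      + x ^ 4 * (15 * y + y ^ 2 - 9 / 2 * y ^ 3) := by
    rw [hδ₀]; ring
  linarith

theorem sq_bounds {y m : ℝ} (y0 : 0 < y) (y1 : y < 1 / 100)
    (hl : 1 + y / 3 + 2 * y ^ 2 / 15 ≤ m) (hu : m ≤ 1 + y / 3 + 2 * y ^ 2 / 15 + y ^ 3 / 10) :
    1 + 2 * y / 3 + 17 / 45 * y ^ 2 + 4 / 45 * y ^ 3 ≤ m ^ 2 ∧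
      m ^ 2 ≤ 1 + 2 * y / 3 + 17 / 45 * y ^ 2 + 3 / 10 * y ^ 3 := by
  have hm : 0 ≤ m := le_trans (by positivity) hl
  constructor
  · have := pow_le_pow_left₀ (by positivity) hl 2
    have : 0 ≤ y ^ 4 := by positivity
    linarith
  · have := pow_le_pow_left₀ hm hu 2
    have : 0 ≤ y ^ 3 * (1 / 100 - y) := mul_nonneg (by positivity) (by linarith)
    have : 0 ≤ y ^ 4 * (1 / 100 - y) := mul_nonneg (by positivity) (by linarith)
    have : 0 ≤ y ^ 5 * (1 / 100 - y) := mul_nonneg (by positivity) (by linarith)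
    have : 0 < y ^ 3 := by positivity
    linarith

theorem one_sub_inv_ge {y m : ℝ} (y0 : 0 < y) (y1 : y < 1 / 100)
    (hl : 1 + y / 3 + 2 * y ^ 2 / 15 ≤ m) :
    y / 3 + y ^ 2 / 45 - y ^ 3 / 10 ≤ 1 - 1 / m := by
  have hm : 0 < m := lt_of_lt_of_le (by positivity) hl
  rw [le_sub_comm, div_le_iff₀ hm]
  have hq : 0 ≤ 1 - (y / 3 + y ^ 2 / 45 - y ^ 3 / 10) := by
    have : 0 < y ^ 3 := by positivity
    nlinarith
  have := mul_le_mul_of_nonneg_left hl hq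
  have : 0 ≤ y ^ 3 * (1 / 100 - y) := mul_nonneg (by positivity) (by linarith)
  have : 0 ≤ y ^ 5 := by positivity
  have : 0 < y ^ 4 := by positivity
  linarith

theorem inv_sq_bounds {y q : ℝ} (y0 : 0 < y) (y1 : y < 1 / 100)
    (hl : 1 + 2 * y / 3 + 17 / 45 * y ^ 2 + 4 / 45 * y ^ 3 ≤ q)
    (hu : q ≤ 1 + 2 * y / 3 + 17 / 45 * y ^ 2 + 3 / 10 * y ^ 3) :
    1 - 2 * y / 3 + y ^ 2 / 15 - y ^ 3 / 10 ≤ 1 / q ∧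
      1 / q ≤ 1 - 2 * y / 3 + y ^ 2 / 15 + y ^ 3 / 5 := by
  have hq0 : 0 < q := lt_of_lt_of_le (by positivity) hl
  have hy3 : 0 < y ^ 3 := by positivity
  have h3 : 0 ≤ y ^ 3 * (1 / 100 - y) := mul_nonneg (by positivity) (by linarith)
  have h4 : 0 ≤ y ^ 4 * (1 / 100 - y) := mul_nonneg (by positivity) (by linarith)
  have h5 : 0 ≤ y ^ 5 * (1 / 100 - y) := mul_nonneg (by positivity) (by linarith)
  have h6 : 0 ≤ y ^ 6 := by positivity
  have h4' : 0 ≤ y ^ 4 := by positivity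
  have h5' : 0 ≤ y ^ 5 := by positivity
  have hy31 : y ^ 3 ≤ 1 := pow_le_one₀ y0.le (by linarith)
  constructor
  · rw [le_div_iff₀ hq0]
    have hq : 0 ≤ 1 - 2 * y / 3 + y ^ 2 / 15 - y ^ 3 / 10 := by
      have : 0 ≤ y ^ 2 := by positivity
      linarith
    have := mul_le_mul_of_nonneg_left hu hq
    linarith
  · rw [div_le_iff₀ hq0]
    have hq : 0 ≤ 1 - 2 * y / 3 + y ^ 2 / 15 + y ^ 3 / 5 := by
      have : 0 ≤ y ^ 2 := by positivity
      linarith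
    have := mul_le_mul_of_nonneg_left hl hq
    linarith

theorem tan_poly_two_scaled {y m κ : ℝ} (y0 : 0 < y) (y1 : y < 1 / 100)
    (hl : 1 + y / 3 + 2 * y ^ 2 / 15 ≤ m) (hu : m ≤ 1 + y / 3 + 2 * y ^ 2 / 15 + y ^ 3 / 10)
    (hκ : 0 ≤ κ) {x δ : ℝ} (hx : x = κ * (y * m ^ 2)) (hx1 : x < 1)
    (hδ : δ = y * ((1 + κ) * (1 + y * m ^ 2)) - x) :
    0 < 45 * (1 - 1 / m) * (1 - x) ^ 4 - (1 - x) ^ 2 * (15 * δ + 7 * y * (δ + x))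
      + 21 * (1 + x) * δ * (δ + 2 * x) := by
  have hm : 0 < m := lt_of_lt_of_le (by positivity) hl
  have hx0 : 0 ≤ x := by rw [hx]; positivity
  obtain ⟨hm2l, hm2u⟩ := sq_bounds y0 y1 hl hu
  obtain ⟨hil, hiu⟩ := inv_sq_bounds y0 y1 hm2l hm2u
  have hx' : x * (1 / m ^ 2) = κ * y := by
    rw [hx]; field_simp
  have hδ' : δ = y + y ^ 2 * m ^ 2 + (1 / m ^ 2 + y - 1) * x := by
    linear_combination hδ - hx' - y * hx
  have hy2 : 0 ≤ y ^ 2 := by positivity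
  have hy3 : 0 < y ^ 3 := by positivity
  have h3 : 0 ≤ y ^ 3 * (1 / 100 - y) := mul_nonneg (by positivity) (by linarith)
  have h4 : 0 ≤ y ^ 4 * (1 / 100 - y) := mul_nonneg (by positivity) (by linarith)
  have h4' : 0 ≤ y ^ 4 := by positivity
  have h5' : 0 ≤ y ^ 5 := by positivity
  have hyx : y ^ 3 * x ≤ y ^ 3 := mul_le_of_le_one_right hy3.le hx1.le
  refine poly_pos_of_bounds y0 y1 hx0 hx1 (one_sub_inv_ge y0 y1 hl) ?_ ?_
  · have h1 := mul_le_mul_of_nonneg_right hil hx0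
    have h2 := mul_le_mul_of_nonneg_left hm2l hy2
    rw [hδ']
    linarith
  · have h1 := mul_le_mul_of_nonneg_right hiu hx0
    have h2 := mul_le_mul_of_nonneg_left hm2u hy2
    rw [hδ']
    linarith

theorem tan_poly_two {h t k : ℝ} (h0 : 0 < h) (h1 : h < 1 / 10)
    (hl : h + h ^ 3 / 3 + 2 * h ^ 5 / 15 ≤ t)
    (hu : t ≤ h + h ^ 3 / 3 + 2 * h ^ 5 / 15 + h ^ 7 / 10) (hk : k * t < 1) (hk0 : 0 ≤ k) :
    0 < 45 * (t - h) * (1 - (k * t) ^ 2) ^ 4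
      - 15 * t * (1 - (k * t) ^ 2) ^ 2 * (h ^ 2 * ((1 + k ^ 2) * (1 + t ^ 2)) - (k * t) ^ 2)
      - 7 * h ^ 4 * t * ((1 + k ^ 2) * (1 + t ^ 2)) * (1 - (k * t) ^ 2) ^ 2
      + 21 * t * (1 + (k * t) ^ 2) *
        ((h ^ 2 * ((1 + k ^ 2) * (1 + t ^ 2))) ^ 2 - (k * t) ^ 4) := by
  obtain ⟨m, rfl⟩ : ∃ m, t = h * m := ⟨t / h, by field_simp⟩
  have hl' : 1 + h ^ 2 / 3 + 2 * (h ^ 2) ^ 2 / 15 ≤ m := by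
    refine le_of_mul_le_mul_left ?_ h0
    linarith
  have hu' : m ≤ 1 + h ^ 2 / 3 + 2 * (h ^ 2) ^ 2 / 15 + (h ^ 2) ^ 3 / 10 := by
    refine le_of_mul_le_mul_left ?_ h0
    linarith
  have hm : 0 < m := lt_of_lt_of_le (by positivity) hl'
  have hT0 : 0 ≤ k * (h * m) := by positivity
  have key := tan_poly_two_scaled (by positivity) (by nlinarith) hl' hu' (sq_nonneg k)
    rfl (by nlinarith) rfl
  refine (mul_pos (mul_pos h0 hm) key).trans_eq ?_
  field_simp
  ring


theorem sin_add_sub_eq_of_cot_tan {θ h : ℝ} (h0 : 0 < h) (hθ : h < θ) (hθ' : θ + h ≤ π / 2) :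
    0 < cos θ / sin θ ∧ cos θ / sin θ * tan h < 1 ∧
      log (sin (θ + h)) - log (sin (θ - h)) =
        log (1 + cos θ / sin θ * tan h) - log (1 - cos θ / sin θ * tan h) ∧
      1 / sin (θ + h) ^ 2 = (1 + (cos θ / sin θ) ^ 2) * (1 + tan h ^ 2) /
        (1 + cos θ / sin θ * tan h) ^ 2 ∧
      1 / sin (θ - h) ^ 2 = (1 + (cos θ / sin θ) ^ 2) * (1 + tan h ^ 2) /
        (1 - cos θ / sin θ * tan h) ^ 2 := by
  have hs : 0 < sin θ := sin_pos_of_pos_of_lt_pi (by linarith) (by linarith [pi_pos])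
  have hc : 0 < cos θ := cos_pos_of_mem_Ioo ⟨by linarith, by linarith⟩
  have hch : 0 < cos h := cos_pos_of_mem_Ioo ⟨by linarith, by linarith⟩
  have ht : 0 < tan h := tan_pos_of_pos_of_lt_pi_div_two h0 (by linarith)
  have hm : 0 < sin (θ - h) := sin_pos_of_pos_of_lt_pi (by linarith) (by linarith [pi_pos])
  have hk : 0 < cos θ / sin θ := by positivity
  have e1 : sin (θ + h) = sin θ * cos h * (1 + cos θ / sin θ * tan h) := by
    rw [sin_add, tan_eq_sin_div_cos]; field_simp
  have e2 : sin (θ - h) = sin θ * cos h * (1 - cos θ / sin θ * tan h) := by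
    rw [sin_sub, tan_eq_sin_div_cos]; field_simp
  have eP : (1 + (cos θ / sin θ) ^ 2) * (1 + tan h ^ 2) = 1 / (sin θ * cos h) ^ 2 := by
    rw [tan_eq_sin_div_cos]
    field_simp
    rw [sin_sq_add_cos_sq, add_comm (cos h ^ 2), sin_sq_add_cos_sq, one_mul]
  have hsc : 0 < sin θ * cos h := by positivity
  have hT : cos θ / sin θ * tan h < 1 := by
    rw [e2] at hm
    have := (mul_pos_iff_of_pos_left hsc).1 hm
    linarith
  have hp1 : 0 < 1 + cos θ / sin θ * tan h := by positivity
  have hp2 : 0 < 1 - cos θ / sin θ * tan h := by linarith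
  refine ⟨hk, hT, ?_, ?_, ?_⟩
  · rw [e1, e2, log_mul hsc.ne' hp1.ne', log_mul hsc.ne' hp2.ne']
    ring
  · rw [e1, eP, mul_pow, div_div]
  · rw [e2, eP, mul_pow, div_div]

theorem log_sin_step_lt {θ h : ℝ} (h0 : 0 < h) (h1 : h < 1 / 10) (hθ : h < θ)
    (hθ' : θ + h ≤ π / 2) :
    log (sin (θ + h)) - log (sin (θ - h)) - 2 * h * (cos θ / sin θ) +
      h ^ 2 / 6 * (1 / sin (θ + h) ^ 2 - 1 / sin (θ - h) ^ 2) < 0 := by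
  obtain ⟨hk, hT, hlog, hp, hm⟩ := sin_add_sub_eq_of_cot_tan h0 hθ hθ'
  have ht : 0 < tan h := tan_pos_of_pos_of_lt_pi_div_two h0 (by linarith)
  have hlt : h ≤ tan h := (lt_tan h0 (by linarith)).le
  rw [hlog, hp, hm]
  have hpoly := tan_poly_one h0 h1 hlt (tan_le_septic h0.le h1) hT hk.le
  set k := cos θ / sin θ
  set t := tan h
  have hL := log_one_add_sub_log_one_sub_le (T := k * t) (by positivity) hT
  have hp1 : 0 < 1 + k * t := by positivity
  have hp2 : 0 < 1 - k * t := by linarith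
  have hw : 0 < 1 - (k * t) ^ 2 := by nlinarith
  have key : 2 * (k * t) + 2 / 3 * ((k * t) ^ 3 / (1 - (k * t) ^ 2) ^ 2) - 2 * h * k +
      h ^ 2 / 6 * ((1 + k ^ 2) * (1 + t ^ 2) / (1 + k * t) ^ 2 -
        (1 + k ^ 2) * (1 + t ^ 2) / (1 - k * t) ^ 2) =
      -(2 * k / 3 / (1 - (k * t) ^ 2) ^ 2 * (h ^ 2 * t * ((1 + k ^ 2) * (1 + t ^ 2)) -
        (3 * (t - h) * (1 - (k * t) ^ 2) ^ 2 + k ^ 2 * t ^ 3))) := by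
    rw [show 1 - (k * t) ^ 2 = (1 + k * t) * (1 - k * t) by ring]
    field_simp
    ring
  have : 0 < 2 * k / 3 / (1 - (k * t) ^ 2) ^ 2 * (h ^ 2 * t * ((1 + k ^ 2) * (1 + t ^ 2)) -
        (3 * (t - h) * (1 - (k * t) ^ 2) ^ 2 + k ^ 2 * t ^ 3)) :=
    mul_pos (by positivity) (by linarith)
  linarith

theorem lt_log_sin_step {θ h : ℝ} (h0 : 0 < h) (h1 : h < 1 / 10) (hθ : h < θ)
    (hθ' : θ + h ≤ π / 2) :
    7 * h ^ 4 / 180 * ((3 * (1 / sin (θ + h) ^ 2) ^ 2 - 2 * (1 / sin (θ + h) ^ 2)) -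
        (3 * (1 / sin (θ - h) ^ 2) ^ 2 - 2 * (1 / sin (θ - h) ^ 2))) <
      log (sin (θ + h)) - log (sin (θ - h)) - 2 * h * (cos θ / sin θ) +
        h ^ 2 / 6 * (1 / sin (θ + h) ^ 2 - 1 / sin (θ - h) ^ 2) := by
  obtain ⟨hk, hT, hlog, hp, hm⟩ := sin_add_sub_eq_of_cot_tan h0 hθ hθ'
  have ht : 0 < tan h := tan_pos_of_pos_of_lt_pi_div_two h0 (by linarith)
  rw [hlog, hp, hm]
  have hpoly := tan_poly_two h0 h1 (quintic_le_tan h0.le h1) (tan_le_septic h0.le h1) hT hk.le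
  set k := cos θ / sin θ
  set t := tan h
  have hL := le_log_one_add_sub_log_one_sub (T := k * t) (by positivity) hT
  have hp1 : 0 < 1 + k * t := by positivity
  have hp2 : 0 < 1 - k * t := by linarith
  have hw : 0 < 1 - (k * t) ^ 2 := by nlinarith
  set P := (1 + k ^ 2) * (1 + t ^ 2)
  have key : 2 * (k * t) + 2 / 3 * ((k * t) ^ 3 / (1 - (k * t) ^ 2) ^ 2) -
      14 / 15 * (((k * t) ^ 5 + (k * t) ^ 7) / (1 - (k * t) ^ 2) ^ 4) - 2 * h * k +
      h ^ 2 / 6 * (P / (1 + k * t) ^ 2 - P / (1 - k * t) ^ 2) -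
      7 * h ^ 4 / 180 * ((3 * (P / (1 + k * t) ^ 2) ^ 2 - 2 * (P / (1 + k * t) ^ 2)) -
        (3 * (P / (1 - k * t) ^ 2) ^ 2 - 2 * (P / (1 - k * t) ^ 2))) =
      2 * k / 45 / (1 - (k * t) ^ 2) ^ 4 * (45 * (t - h) * (1 - (k * t) ^ 2) ^ 4
      - 15 * t * (1 - (k * t) ^ 2) ^ 2 * (h ^ 2 * P - (k * t) ^ 2)
      - 7 * h ^ 4 * t * P * (1 - (k * t) ^ 2) ^ 2
      + 21 * t * (1 + (k * t) ^ 2) * ((h ^ 2 * P) ^ 2 - (k * t) ^ 4)) := by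
    rw [show 1 - (k * t) ^ 2 = (1 + k * t) * (1 - k * t) by ring]
    field_simp
    ring
  have := mul_pos (show 0 < 2 * k / 45 / (1 - (k * t) ^ 2) ^ 4 by positivity) hpoly
  linarith

theorem sum_Icc_one_eq_sum_range {f : ℕ → ℝ} (h0 : f 0 = 0) (n : ℕ) :
    ∑ l ∈ Finset.Icc 1 (n - 1), f l = ∑ l ∈ range n, f l := by
  rcases n with _ | n
  · simp
  · rw [Nat.add_sub_cancel, range_eq_Ico, Finset.sum_eq_sum_Ico_succ_bot (Nat.succ_pos n), h0,
      zero_add]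
    rfl

theorem C_eq_sum_range (n : ℕ) (ν : ℤ) :
    C n ν = ∑ l ∈ range n, cos (2 * π * ν * l / n) / sin (π * l / n) :=
  sum_Icc_one_eq_sum_range (by simp) n

theorem sum_range_two_mul (f : ℕ → ℝ) (n : ℕ) :
    ∑ l ∈ range (2 * n), f l = ∑ j ∈ range n, (f (2 * j) + f (2 * j + 1)) := by
  induction n with
  | zero => simp
  | succ n ih =>
    rw [Finset.sum_range_succ, ← ih, mul_add, mul_one, Finset.sum_range_succ, Finset.sum_range_succ]
    ring

theorem C_sub (n : ℕ) (ν : ℤ) : C n (n - ν) = C n ν := by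
  unfold C
  refine Finset.sum_congr rfl fun l hl => ?_
  have hn : (n : ℝ) ≠ 0 := by
    rw [Finset.mem_Icc] at hl
    exact_mod_cast (by omega : n ≠ 0)
  congr 1
  push_cast
  rw [show 2 * π * ((n : ℝ) - ν) * l / n = l * (2 * π) - 2 * π * ν * l / n by field_simp]
  exact cos_nat_mul_two_pi_sub _ _

theorem C_eq_average {n : ℕ} (hn : 0 < n) (ν : ℤ) :
    C n ν = (C (2 * n) ν + C (2 * n) (ν + n)) / 2 := by
  have hn' : (n : ℝ) ≠ 0 := by exact_mod_cast hn.ne'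
  simp only [C_eq_sum_range, sum_range_two_mul, ← Finset.sum_add_distrib]
  rw [Finset.sum_div]
  refine Finset.sum_congr rfl fun j _ => ?_
  push_cast
  have h1 : 2 * π * ((ν : ℝ) + n) * (2 * j) / (2 * n) = 2 * π * ν * j / n + j * (2 * π) := by
    field_simp
  have h2 : 2 * π * ((ν : ℝ) + n) * (2 * j + 1) / (2 * n) =
      2 * π * ν * (2 * j + 1) / (2 * n) + π + j * (2 * π) := by
    field_simp; ring
  rw [h1, h2, cos_add_nat_mul_two_pi, cos_add_nat_mul_two_pi, cos_add_pi,
    show 2 * π * (ν : ℝ) * (2 * j) / (2 * n) = 2 * π * ν * j / n by field_simp,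
    show π * (2 * (j : ℝ)) / (2 * n) = π * j / n by field_simp]
  ring

theorem two_sin_mul_sum_sin (θ : ℝ) (n : ℕ) :
    2 * sin (θ / 2) * ∑ l ∈ range n, sin (l * θ) = cos (θ / 2) - cos (n * θ - θ / 2) := by
  induction n with
  | zero => simp
  | succ n ih =>
    rw [Finset.sum_range_succ, mul_add, ih]
    have e1 : ((n + 1 : ℕ) : ℝ) * θ - θ / 2 = n * θ + θ / 2 := by push_cast; ring
    rw [e1, cos_sub (n * θ), cos_add]
    ring

theorem C_add_one_sub {n : ℕ} (hn : 0 < n) (ν : ℤ)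
    (hs : sin ((2 * ν + 1) * π / (2 * n)) ≠ 0) :
    C n (ν + 1) - C n ν =
      -2 * (cos ((2 * ν + 1) * π / (2 * n)) / sin ((2 * ν + 1) * π / (2 * n))) := by
  have hn' : (n : ℝ) ≠ 0 := by exact_mod_cast hn.ne'
  set φ := (2 * ν + 1) * π / (2 * n) with hφ
  have hsum := two_sin_mul_sum_sin (2 * φ) n
  rw [show 2 * φ / 2 = φ by ring, show (n : ℝ) * (2 * φ) - φ = π - φ + ν * (2 * π) by
    rw [hφ]; field_simp; ring, cos_add_int_mul_two_pi, cos_pi_sub] at hsum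
  have hterm : C n (ν + 1) - C n ν = -2 * ∑ l ∈ range n, sin (l * (2 * φ)) := by
    rw [C_eq_sum_range, C_eq_sum_range, ← Finset.sum_sub_distrib, Finset.mul_sum]
    refine Finset.sum_congr rfl fun l hl => ?_
    rcases Nat.eq_zero_or_pos l with rfl | hl0
    · simp
    have hl' : (l : ℝ) < n := by exact_mod_cast Finset.mem_range.1 hl
    have hl0' : (0 : ℝ) < l := by exact_mod_cast hl0
    have hsl : 0 < sin (π * l / n) := by
      apply sin_pos_of_pos_of_lt_pi (by positivity)
      rw [div_lt_iff₀ (by linarith)]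
      exact mul_lt_mul_of_pos_left hl' pi_pos
    rw [← sub_div, cos_sub_cos, div_eq_iff hsl.ne']
    push_cast
    rw [show (2 * π * ((ν : ℝ) + 1) * l / n + 2 * π * ν * l / n) / 2 = l * (2 * φ) by
      rw [hφ]; field_simp; ring,
      show (2 * π * ((ν : ℝ) + 1) * l / n - 2 * π * ν * l / n) / 2 = π * l / n by
      field_simp; ring]
  have hcot : ∑ l ∈ range n, sin (l * (2 * φ)) = cos φ / sin φ := by
    rw [eq_div_iff hs]
    linarith
  rw [hterm, hcot]

theorem antitone_toward_half {f : ℕ → ℝ} {m : ℕ}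
    (mono : ∀ ν, 1 ≤ ν → ν + 1 ≤ m → f (ν + 1) < f ν) {ν : ℕ} (h1 : 1 ≤ ν) (h2 : ν < m) :
    f m < f ν := by
  induction m, h2 using Nat.le_induction with
  | base => exact mono ν h1 le_rfl
  | succ k hk ih =>
    exact (mono k (by omega) le_rfl).trans (ih fun j hj hj' => mono j hj (by omega))

theorem half_lt_of_symm {f : ℕ → ℝ} {m : ℕ}
    (symm : ∀ ν, 0 < ν → ν < 2 * m → f (2 * m - ν) = f ν)
    (mono : ∀ ν, 1 ≤ ν → ν + 1 ≤ m → f (ν + 1) < f ν) {ν : ℕ} (h0 : 0 < ν) (h2 : ν < 2 * m)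
    (hne : ν ≠ m) : f m < f ν := by
  rcases lt_or_gt_of_ne hne with h | h
  · exact antitone_toward_half mono h0 h
  · rw [← symm ν h0 h2]
    exact antitone_toward_half mono (by omega) (by omega)

theorem pos_of_average_of_symm_of_mono {D : ℕ → ℕ → ℝ} (N : ℕ)
    (avg : ∀ n ν, 0 < ν → ν < n → D n ν = (D (2 * n) ν + D (2 * n) (ν + n)) / 2)
    (symm : ∀ n ν, 0 < ν → ν < n → D n (n - ν) = D n ν)
    (mono : ∀ m ν, N ≤ m → 1 ≤ ν → ν + 1 ≤ m → D (2 * m) (ν + 1) < D (2 * m) ν)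
    (lim : Filter.Tendsto (fun n => D (2 * n) n) Filter.atTop (nhds 0))
    {n ν : ℕ} (h0 : 0 < ν) (hn : ν < n) : 0 < D n ν := by
  have half : ∀ m ν, N ≤ m → 0 < ν → ν < 2 * m → ν ≠ m → D (2 * m) m < D (2 * m) ν :=
    fun m ν hm h0 h2 hne => half_lt_of_symm (symm (2 * m)) (fun j => mono m j hm) h0 h2 hne
  have descend : ∀ (P : ℝ → Prop) (K : ℕ), (∀ a b, P a → P b → P ((a + b) / 2)) →
      (∀ m ν, K ≤ m → 0 < ν → ν < m → P (D m ν)) → ∀ m ν, 0 < ν → ν < m → P (D m ν) := by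
    intro P K hP hK
    suffices h : ∀ d m, K ≤ m + d → ∀ ν, 0 < ν → ν < m → P (D m ν) from
      fun m ν => h K m (by omega) ν
    intro d
    induction d with
    | zero => exact fun m hm ν => hK m ν hm
    | succ d ih =>
      intro m hm ν h0 h1
      rw [avg m ν h0 h1]
      exact hP _ _ (ih _ (by omega) _ h0 (by omega)) (ih _ (by omega) _ (by omega) (by omega))
  have nonneg : ∀ m ν, 0 < ν → ν < m → 0 ≤ D m ν := by
    intro m ν h0 h1
    refine le_of_forall_pos_lt_add fun ε hε => ?_
    obtain ⟨K, hK⟩ := Filter.eventually_atTop.1 (lim.eventually (lt_mem_nhds (neg_lt_zero.2 hε)))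
    have := descend (fun x => -ε < x) (max K N) (fun a b ha hb => by linarith) (by
      intro m ν hm h0 h1
      have hb := hK m (le_of_max_le_left hm)
      have large : ∀ j, 0 < j → j < 2 * m → -ε < D (2 * m) j := by
        intro j hj hj'
        rcases eq_or_ne j m with rfl | hne
        · exact hb
        · exact hb.trans (half m j (le_of_max_le_right hm) hj hj' hne)
      rw [avg m ν h0 h1]
      have h2 := large ν h0 (by omega)
      have h3 := large (ν + m) (by omega) (by omega)
      linarith) m ν h0 h1
    linarith
  refine descend (fun x => 0 < x) N (fun a b ha hb => by linarith) ?_ n ν h0 hn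
  intro m ν hm h0 h1
  rw [avg m ν h0 h1]
  have hb := nonneg (2 * m) m (by omega) (by omega)
  have h2 := half m ν hm h0 (by omega) (by omega)
  have h3 := half m (ν + m) hm (by omega) (by omega) (by omega)
  linarith

noncomputable def cscMain (n : ℕ) (x : ℝ) : ℝ :=
  -(2 * n / π) * log (2 * sin x) - (π / (12 * n)) * (1 / sin x) ^ 2

noncomputable def cscCorrection (n : ℕ) (x : ℝ) : ℝ :=
  (7 * π ^ 3 / (1440 * (n : ℝ) ^ 3)) * (1 + 2 * cos x ^ 2) * (1 / sin x) ^ 4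

theorem cscMain_pi_sub (n : ℕ) (x : ℝ) : cscMain n (π - x) = cscMain n x := by
  rw [cscMain, cscMain, sin_pi_sub]

theorem cscCorrection_pi_sub (n : ℕ) (x : ℝ) : cscCorrection n (π - x) = cscCorrection n x := by
  rw [cscCorrection, cscCorrection, sin_pi_sub, cos_pi_sub, neg_sq]

theorem cscMain_two_mul {n : ℕ} (hn : 0 < n) {x : ℝ} (h0 : 0 < x) (h1 : x < π / 2) :
    cscMain n (2 * x) = (cscMain (2 * n) x + cscMain (2 * n) (x + π / 2)) / 2 := by
  have hn' : (n : ℝ) ≠ 0 := by exact_mod_cast hn.ne'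
  have hs : 0 < sin x := sin_pos_of_pos_of_lt_pi h0 (by linarith)
  have hc : 0 < cos x := cos_pos_of_mem_Ioo ⟨by linarith, h1⟩
  have hsc := sin_sq_add_cos_sq x
  rw [cscMain, cscMain, cscMain, sin_two_mul, sin_add_pi_div_two,
    show 2 * (2 * sin x * cos x) = 2 * sin x * (2 * cos x) by ring,
    log_mul (by positivity) (by positivity)]
  have e : (1 / sin x) ^ 2 + (1 / cos x) ^ 2 = 4 * (1 / (2 * sin x * cos x)) ^ 2 := by
    field_simp
    linarith
  have e' : (1 / cos x) ^ 2 = 4 * (1 / (2 * sin x * cos x)) ^ 2 - (1 / sin x) ^ 2 := by linarith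
  rw [e']
  push_cast
  field_simp
  ring

theorem cscCorrection_two_mul {n : ℕ} (hn : 0 < n) {x : ℝ} (h0 : 0 < x) (h1 : x < π / 2) :
    cscCorrection n (2 * x) =
      (cscCorrection (2 * n) x + cscCorrection (2 * n) (x + π / 2)) / 2 := by
  have hn' : (n : ℝ) ≠ 0 := by exact_mod_cast hn.ne'
  have hs : sin x ≠ 0 := (sin_pos_of_pos_of_lt_pi h0 (by linarith)).ne'
  have hc : cos x ≠ 0 := (cos_pos_of_mem_Ioo ⟨by linarith, h1⟩).ne'
  rw [cscCorrection, cscCorrection, cscCorrection, sin_two_mul, sin_add_pi_div_two,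
    cos_add_pi_div_two, cos_two_mul]
  have hsc : sin x ^ 2 = 1 - cos x ^ 2 := by linarith [sin_sq_add_cos_sq x]
  have e : (1 + 2 * (2 * cos x ^ 2 - 1) ^ 2) * (1 / (2 * sin x * cos x)) ^ 4 =
      ((1 + 2 * cos x ^ 2) * (1 / sin x) ^ 4 + (1 + 2 * (-sin x) ^ 2) * (1 / cos x) ^ 4) / 16 := by
    field_simp
    rw [show sin x ^ 4 = (sin x ^ 2) ^ 2 by ring, hsc]
    ring
  rw [mul_assoc, e]
  push_cast
  field_simp
  ring

theorem step_angles {m ν : ℕ} (hm : 8 ≤ m) (h1 : 1 ≤ ν) (h2 : ν + 1 ≤ m) :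
    ∃ θ h : ℝ, 0 < h ∧ h < 1 / 10 ∧ h < θ ∧ θ + h ≤ π / 2 ∧
      π * (ν + 1 : ℕ) / (2 * m : ℕ) = θ + h ∧ π * ν / (2 * m : ℕ) = θ - h ∧
      π = 4 * m * h ∧
      C (2 * m) (ν + 1 : ℕ) - C (2 * m) ν = -2 * (cos θ / sin θ) := by
  have hm' : (8 : ℝ) ≤ m := by exact_mod_cast hm
  have h1' : (1 : ℝ) ≤ ν := by exact_mod_cast h1
  have h2' : (ν : ℝ) + 1 ≤ m := by exact_mod_cast h2
  have hm0 : (0 : ℝ) < m := by linarith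
  have hpi : π = 4 * m * (π / (4 * m)) := by field_simp
  have hp : 0 < π / (4 * m) := by positivity
  refine ⟨(2 * ν + 1) * π / (2 * (2 * m : ℕ)), π / (4 * m), hp, ?_, ?_, ?_, ?_, ?_, hpi, ?_⟩
  · rw [div_lt_iff₀ (by positivity)]
    linarith [pi_lt_d2]
  · push_cast
    rw [show (2 * (ν : ℝ) + 1) * π / (2 * (2 * m)) = (2 * ν + 1) * (π / (4 * m)) by
      field_simp; ring]
    nlinarith
  · push_cast
    rw [show (2 * (ν : ℝ) + 1) * π / (2 * (2 * m)) + π / (4 * m) =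
      2 * (ν + 1) * (π / (4 * m)) by field_simp; ring]
    nlinarith
  · push_cast
    field_simp
    ring
  · push_cast
    field_simp
    ring
  · have := C_add_one_sub (n := 2 * m) (by omega) ν (ne_of_gt (sin_pos_of_pos_of_lt_pi ?_ ?_))
    · rw [← Nat.cast_one, ← Nat.cast_add] at this
      exact_mod_cast this
    · push_cast
      positivity
    · push_cast
      rw [div_lt_iff₀ (by positivity)]
      nlinarith [pi_pos]

theorem C_sub_cscMain_lt {m ν : ℕ} (hm : 8 ≤ m) (h1 : 1 ≤ ν) (h2 : ν + 1 ≤ m) :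
    C (2 * m) (ν + 1 : ℕ) - cscMain (2 * m) (π * (ν + 1 : ℕ) / (2 * m : ℕ)) <
      C (2 * m) ν - cscMain (2 * m) (π * ν / (2 * m : ℕ)) := by
  obtain ⟨θ, h, h0, hh, hθ, hθ', e1, e2, hpi, hC⟩ := step_angles hm h1 h2
  have hm0 : (m : ℝ) ≠ 0 := by exact_mod_cast (by omega : m ≠ 0)
  rw [e1, e2]
  have hlt := log_sin_step_lt h0 hh hθ hθ'
  have s1 : 0 < sin (θ + h) := sin_pos_of_pos_of_lt_pi (by linarith) (by linarith [pi_pos])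
  have s2 : 0 < sin (θ - h) := sin_pos_of_pos_of_lt_pi (by linarith) (by linarith [pi_pos])
  rw [cscMain, cscMain, log_mul two_ne_zero s1.ne', log_mul two_ne_zero s2.ne']
  have c1 : 2 * ((2 * m : ℕ) : ℝ) / π = 1 / h := by rw [hpi]; push_cast; field_simp; norm_num
  have c2 : π / (12 * ((2 * m : ℕ) : ℝ)) = h / 6 := by rw [hpi]; push_cast; field_simp; norm_num
  rw [c1, c2]
  have hdiv := mul_neg_of_pos_of_neg (one_div_pos.2 h0) hlt
  have : 1 / h * (log (sin (θ + h)) - log (sin (θ - h)) - 2 * h * (cos θ / sin θ) +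
      h ^ 2 / 6 * (1 / sin (θ + h) ^ 2 - 1 / sin (θ - h) ^ 2)) =
      1 / h * (log (sin (θ + h)) - log (sin (θ - h))) - 2 * (cos θ / sin θ) +
      h / 6 * ((1 / sin (θ + h)) ^ 2 - (1 / sin (θ - h)) ^ 2) := by
    field_simp
  linarith

theorem cscMain_add_cscCorrection_sub_C_lt {m ν : ℕ} (hm : 8 ≤ m) (h1 : 1 ≤ ν) (h2 : ν + 1 ≤ m) :
    cscMain (2 * m) (π * (ν + 1 : ℕ) / (2 * m : ℕ)) +
        cscCorrection (2 * m) (π * (ν + 1 : ℕ) / (2 * m : ℕ)) - C (2 * m) (ν + 1 : ℕ) <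
      cscMain (2 * m) (π * ν / (2 * m : ℕ)) + cscCorrection (2 * m) (π * ν / (2 * m : ℕ)) -
        C (2 * m) ν := by
  obtain ⟨θ, h, h0, hh, hθ, hθ', e1, e2, hpi, hC⟩ := step_angles hm h1 h2
  have hm0 : (m : ℝ) ≠ 0 := by exact_mod_cast (by omega : m ≠ 0)
  rw [e1, e2]
  have hlt := lt_log_sin_step h0 hh hθ hθ'
  have s1 : 0 < sin (θ + h) := sin_pos_of_pos_of_lt_pi (by linarith) (by linarith [pi_pos])
  have s2 : 0 < sin (θ - h) := sin_pos_of_pos_of_lt_pi (by linarith) (by linarith [pi_pos])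
  have corr : ∀ x, 0 < sin x → cscCorrection (2 * m) x =
      7 * h ^ 3 / 180 * (3 * (1 / sin x ^ 2) ^ 2 - 2 * (1 / sin x ^ 2)) := by
    intro x hx
    rw [cscCorrection, cos_sq', hpi]
    push_cast
    field_simp
    ring
  rw [corr _ s1, corr _ s2]
  rw [cscMain, cscMain, log_mul two_ne_zero s1.ne', log_mul two_ne_zero s2.ne']
  have c1 : 2 * ((2 * m : ℕ) : ℝ) / π = 1 / h := by rw [hpi]; push_cast; field_simp; norm_num
  have c2 : π / (12 * ((2 * m : ℕ) : ℝ)) = h / 6 := by rw [hpi]; push_cast; field_simp; norm_num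
  rw [c1, c2]
  rw [one_div_pow (sin (θ + h)) 2, one_div_pow (sin (θ - h)) 2]
  have hdiv := mul_lt_mul_of_pos_left hlt (one_div_pos.2 h0)
  generalize log (sin (θ + h)) = a at *
  generalize log (sin (θ - h)) = b at *
  generalize 1 / sin (θ + h) ^ 2 = p at *
  generalize 1 / sin (θ - h) ^ 2 = q at *
  generalize cos θ / sin θ = k at *
  have e3 : 1 / h * (a - b - 2 * h * k + h ^ 2 / 6 * (p - q)) =
      1 / h * (a - b) - 2 * k + h / 6 * (p - q) := by
    field_simp
  have e4 : 1 / h * (7 * h ^ 4 / 180 * ((3 * p ^ 2 - 2 * p) - (3 * q ^ 2 - 2 * q))) =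
      7 * h ^ 3 / 180 * ((3 * p ^ 2 - 2 * p) - (3 * q ^ 2 - 2 * q)) := by
    field_simp
  rw [e3, e4] at hdiv
  linarith

theorem tendsto_C_sub_cscMain
    (hlim : Filter.Tendsto (fun n : ℕ => C (2 * n) n + 4 * n / π * log 2) Filter.atTop (nhds 0)) :
    Filter.Tendsto (fun n : ℕ => C (2 * n) n - cscMain (2 * n) (π * n / (2 * n : ℕ)))
      Filter.atTop (nhds 0) := by
  have h := hlim.add (tendsto_const_div_atTop_nhds_zero_nat (π / 24))
  rw [add_zero] at h
  refine h.congr' ?_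
  filter_upwards [Filter.eventually_gt_atTop 0] with n hn
  have hn' : (n : ℝ) ≠ 0 := by exact_mod_cast hn.ne'
  push_cast
  rw [show π * (n : ℝ) / (2 * n) = π / 2 by field_simp, cscMain, sin_pi_div_two]
  push_cast
  field_simp
  ring

theorem tendsto_cscCorrection :
    Filter.Tendsto (fun n : ℕ => cscCorrection (2 * n) (π * n / (2 * n : ℕ)))
      Filter.atTop (nhds 0) := by
  have h := ((tendsto_const_div_atTop_nhds_zero_nat (1 : ℝ)).pow 3).const_mul (7 * π ^ 3 / 11520)
  rw [zero_pow three_ne_zero, mul_zero] at h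
  refine h.congr' ?_
  filter_upwards [Filter.eventually_gt_atTop 0] with n hn
  have hn' : (n : ℝ) ≠ 0 := by exact_mod_cast hn.ne'
  push_cast
  rw [show π * (n : ℝ) / (2 * n) = π / 2 by field_simp, cscCorrection, sin_pi_div_two,
    cos_pi_div_two]
  push_cast
  field_simp
  norm_num

theorem average_of_two_mul {F : ℕ → ℝ → ℝ}
    (hF : ∀ n x, 0 < n → 0 < x → x < π / 2 →
      F n (2 * x) = (F (2 * n) x + F (2 * n) (x + π / 2)) / 2)
    {n ν : ℕ} (h0 : 0 < ν) (h1 : ν < n) :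
    F n (π * ν / n) = (F (2 * n) (π * ν / (2 * n : ℕ)) +
      F (2 * n) (π * (ν + n : ℕ) / (2 * n : ℕ))) / 2 := by
  have h0' : (0 : ℝ) < ν := by exact_mod_cast h0
  have h1' : (ν : ℝ) < n := by exact_mod_cast h1
  have hn : (0 : ℝ) < n := by linarith
  have := hF n (π * ν / (2 * n)) (by omega) (by positivity) (by
    rw [div_lt_div_iff₀ (by positivity) two_pos]
    nlinarith [pi_pos])
  rw [show 2 * (π * (ν : ℝ) / (2 * n)) = π * ν / n by field_simp,
    show π * (ν : ℝ) / (2 * n) + π / 2 = π * (ν + n : ℕ) / (2 * n) by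
      push_cast; field_simp] at this
  push_cast at this ⊢
  exact this

theorem C_bounds_of_tendsto
    (hlim : Filter.Tendsto (fun n : ℕ => C (2 * n) n + 4 * n / π * log 2) Filter.atTop (nhds 0))
    {n ν : ℕ} (h0 : 0 < ν) (hn : ν < n) :
    cscMain n (π * ν / n) < C n ν ∧
      C n ν < cscMain n (π * ν / n) + cscCorrection n (π * ν / n) := by
  have havg : ∀ n ν : ℕ, 0 < ν → ν < n → C n ν = (C (2 * n) ν + C (2 * n) (ν + n : ℕ)) / 2 :=
    fun n ν _ h => by rw [C_eq_average (by omega)]; push_cast; rfl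
  have hC : ∀ n ν : ℕ, 0 < ν → ν < n → C n (n - ν : ℕ) = C n ν := fun n ν _ h => by
    rw [Nat.cast_sub h.le, C_sub]
  have hrefl : ∀ n ν : ℕ, 0 < ν → ν < n → π * (n - ν : ℕ) / n = π - π * ν / n := fun n ν _ h => by
    have : (n : ℝ) ≠ 0 := by exact_mod_cast (by omega : n ≠ 0)
    rw [Nat.cast_sub h.le]
    field_simp
  constructor
  · rw [← sub_pos]
    refine pos_of_average_of_symm_of_mono
      (D := fun n ν => C n ν - cscMain n (π * ν / n)) 8 ?_ ?_ ?_ ?_ h0 hn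
    · intro n ν h0 h
      rw [havg n ν h0 h, average_of_two_mul (F := cscMain) (fun _ _ h => cscMain_two_mul h) h0 h]
      ring
    · intro n ν h0 h
      rw [hC n ν h0 h, hrefl n ν h0 h, cscMain_pi_sub]
    · exact fun m ν => C_sub_cscMain_lt
    · exact tendsto_C_sub_cscMain hlim
  · rw [← sub_pos]
    refine pos_of_average_of_symm_of_mono
      (D := fun n ν => cscMain n (π * ν / n) + cscCorrection n (π * ν / n) - C n ν)
      8 ?_ ?_ ?_ ?_ h0 hn
    · intro n ν h0 h
      rw [havg n ν h0 h, average_of_two_mul (F := cscMain) (fun _ _ h => cscMain_two_mul h) h0 h,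
        average_of_two_mul (F := cscCorrection) (fun _ _ h => cscCorrection_two_mul h) h0 h]
      ring
    · intro n ν h0 h
      rw [hC n ν h0 h, hrefl n ν h0 h, cscMain_pi_sub, cscCorrection_pi_sub]
    · exact fun m ν => cscMain_add_cscCorrection_sub_C_lt
    · have := (tendsto_cscCorrection).sub (tendsto_C_sub_cscMain hlim)
      rw [sub_zero] at this
      exact this.congr fun n => by ring

theorem cos_le_quartic {x : ℝ} (hx : 0 ≤ x) : cos x ≤ 1 - x ^ 2 / 2 + x ^ 4 / 24 := by
  rw [← sub_nonneg]
  refine nonneg_of_hasDerivAt_nonneg (b := x + 1)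
    (f := fun x => 1 - x ^ 2 / 2 + x ^ 4 / 24 - cos x) (f' := fun x => sin x - (x - x ^ 3 / 6))
    (by simp) ?_ (fun y hy _ => sub_nonneg.2 (sin_ge_sub_cube hy.le)) hx (by linarith)
  intro y _ _
  refine (((((hasDerivAt_pow 2 y).div_const 2).const_sub 1).add
    ((hasDerivAt_pow 4 y).div_const 24)).sub (hasDerivAt_cos y)).congr_deriv ?_
  push_cast
  ring

theorem cube_mul_cos_le_sin_cube {x : ℝ} (h0 : 0 ≤ x) (h1 : x ≤ π / 2) :
    x ^ 3 * cos x ≤ sin x ^ 3 := by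
  have hx : x < 2 := by linarith [pi_lt_d2]
  have hsq : x ^ 2 ≤ 4 := by nlinarith
  have hlow : 0 ≤ x - x ^ 3 / 6 := by nlinarith
  calc x ^ 3 * cos x ≤ x ^ 3 * (1 - x ^ 2 / 2 + x ^ 4 / 24) := by
        gcongr
        exact cos_le_quartic h0
    _ ≤ (x - x ^ 3 / 6) ^ 3 := by
        have : 0 ≤ x ^ 7 * (9 - x ^ 2) := mul_nonneg (by positivity) (by linarith)
        nlinarith
    _ ≤ sin x ^ 3 := by
        gcongr
        exact sin_ge_sub_cube h0

theorem convexOn_inv_sub_cot :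
    ConvexOn ℝ (Set.Ioc 0 (π / 2)) fun x => 1 / x - cos x / sin x := by
  have hs : ∀ {x}, x ∈ Set.Ioc 0 (π / 2) → 0 < sin x := fun hx =>
    sin_pos_of_pos_of_lt_pi hx.1 (by linarith [hx.2, pi_pos])
  have d1 : ∀ x ∈ Set.Ioc 0 (π / 2), HasDerivAt (fun x => 1 / x - cos x / sin x)
      (1 / sin x ^ 2 - 1 / x ^ 2) x := by
    intro x hx
    have h1 := hs hx
    have h2 := hx.1
    refine (((hasDerivAt_const x (1 : ℝ)).div (hasDerivAt_id x) h2.ne').sub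
      ((hasDerivAt_cos x).div (hasDerivAt_sin x) h1.ne')).congr_deriv ?_
    simp only [id]
    field_simp
    linear_combination x ^ 2 * sin_sq_add_cos_sq x
  have d2 : ∀ x ∈ Set.Ioc 0 (π / 2), HasDerivAt (fun x => 1 / sin x ^ 2 - 1 / x ^ 2)
      (2 / x ^ 3 - 2 * cos x / sin x ^ 3) x := by
    intro x hx
    have h1 := hs hx
    have h2 := hx.1
    refine (((hasDerivAt_const x (1 : ℝ)).div ((hasDerivAt_sin x).pow 2) (pow_pos h1 2).ne').sub
      ((hasDerivAt_const x (1 : ℝ)).div (hasDerivAt_pow 2 x) (by positivity))).congr_deriv ?_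
    simp only [Pi.pow_apply]
    field_simp
    ring
  refine convexOn_of_hasDerivWithinAt2_nonneg (f' := fun x => 1 / sin x ^ 2 - 1 / x ^ 2)
    (f'' := fun x => 2 / x ^ 3 - 2 * cos x / sin x ^ 3) (convex_Ioc _ _)
    (fun x hx => (d1 x hx).continuousAt.continuousWithinAt) ?_ ?_ ?_
  · exact fun x hx => (d1 x (interior_subset hx)).hasDerivWithinAt
  · exact fun x hx => (d2 x (interior_subset hx)).hasDerivWithinAt
  · intro x hx
    have hx := interior_subset hx
    have h1 := hs hx
    have h2 := hx.1
    rw [sub_nonneg, div_le_div_iff₀ (by positivity) (by positivity)]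
    linarith [cube_mul_cos_le_sin_cube hx.1.le hx.2]

theorem two_mul_inv_sub_cot_le {x d : ℝ} (h0 : 0 < x) (hd : 0 ≤ d) (h1 : x + 2 * d ≤ π / 2) :
    2 * (1 / (x + d) - cos (x + d) / sin (x + d)) ≤
      (1 / x - cos x / sin x) + (1 / (x + 2 * d) - cos (x + 2 * d) / sin (x + 2 * d)) := by
  have hx : x ∈ Set.Ioc 0 (π / 2) := ⟨h0, by linarith⟩
  have hy : x + 2 * d ∈ Set.Ioc 0 (π / 2) := ⟨by linarith, h1⟩
  obtain ⟨-, hconv⟩ := convexOn_inv_sub_cot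
  have := hconv hx hy (one_half_pos (α := ℝ)).le one_half_pos.le (add_halves 1)
  simp only [smul_eq_mul] at this
  rw [show 1 / 2 * x + 1 / 2 * (x + 2 * d) = x + d by ring] at this
  linarith

theorem inv_sub_cot_le_two_mul {x : ℝ} (h0 : 0 < x) (h1 : 2 * x ≤ π / 2) :
    1 / x - cos x / sin x ≤ 1 / (2 * x) - cos (2 * x) / sin (2 * x) := by
  have hs : 0 < sin x := sin_pos_of_pos_of_lt_pi h0 (by linarith)
  have hs2 : 0 < sin (2 * x) := sin_pos_of_pos_of_lt_pi (by linarith) (by linarith)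
  have hinv : 1 / (2 * x) ≤ 1 / sin (2 * x) := one_div_le_one_div_of_le hs2 (sin_le (by linarith))
  have hcot : cos x / sin x = 1 / sin (2 * x) + cos (2 * x) / sin (2 * x) := by
    have hc : 0 < cos x := cos_pos_of_mem_Ioo ⟨by linarith, by linarith⟩
    rw [sin_two_mul, cos_two_mul]
    field_simp
    ring
  have : 1 / x = 2 * (1 / (2 * x)) := by field_simp
  linarith

theorem inv_sub_cot_mem_Icc {x : ℝ} (h0 : 0 < x) (h1 : x < 1) :
    1 / x - cos x / sin x ∈ Set.Icc 0 x := by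
  have hpi := pi_gt_three
  have hs : 0 < sin x := sin_pos_of_pos_of_lt_pi h0 (by linarith)
  have hc : 0 < cos x := cos_pos_of_mem_Ioo ⟨by linarith, by linarith⟩
  constructor
  · have ht := le_tan h0.le (by linarith)
    rw [tan_eq_sin_div_cos, le_div_iff₀ hc] at ht
    rw [sub_nonneg, div_le_div_iff₀ hs h0]
    linarith
  · have : (1 - x ^ 2 / 2) / x ≤ cos x / sin x :=
      div_le_div₀ hc.le one_sub_sq_div_two_le_cos hs (sin_le h0.le)
    have e : (1 - x ^ 2 / 2) / x = 1 / x - x / 2 := by field_simp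
    linarith

theorem alternating_sum_bounds {a : ℕ → ℝ} {n : ℕ} (hn : 1 ≤ n) (h12 : a 1 ≤ a 2)
    (hconv : ∀ j, 1 ≤ j → j + 2 ≤ 2 * n → 2 * a (j + 1) ≤ a j + a (j + 2)) :
    a (2 * n) - a 1 ≤ 2 * ∑ i ∈ range n, (a (2 * i + 2) - a (2 * i + 1)) ∧
      2 * ∑ i ∈ range n, (a (2 * i + 2) - a (2 * i + 1)) ≤
        2 * a (2 * n) - a 1 - a (2 * n - 1) := by
  induction n, hn using Nat.le_induction with
  | base => constructor <;> norm_num <;> linarith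
  | succ n hn ih =>
    obtain ⟨ih1, ih2⟩ := ih fun j hj hj' => hconv j hj (by omega)
    obtain ⟨k, rfl⟩ : ∃ k, n = k + 1 := ⟨n - 1, by omega⟩
    have c1 := hconv (2 * (k + 1)) (by omega) (by omega)
    have c2 := hconv (2 * (k + 1) - 1) (by omega) (by omega)
    rw [show 2 * (k + 1) - 1 + 1 = 2 * (k + 1) by omega,
      show 2 * (k + 1) - 1 + 2 = 2 * (k + 1) + 1 by omega] at c2
    rw [Finset.sum_range_succ, show 2 * (k + 1 + 1) = 2 * (k + 1) + 2 by ring,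
      show 2 * (k + 1) + 2 - 1 = 2 * (k + 1) + 1 by omega]
    constructor <;> linarith

theorem tendsto_sum_inv_sub_cot :
    Filter.Tendsto (fun n : ℕ => ∑ i ∈ range n,
      ((1 / (π * (2 * i + 2 : ℕ) / (4 * n)) -
          cos (π * (2 * i + 2 : ℕ) / (4 * n)) / sin (π * (2 * i + 2 : ℕ) / (4 * n))) -
        (1 / (π * (2 * i + 1 : ℕ) / (4 * n)) -
          cos (π * (2 * i + 1 : ℕ) / (4 * n)) / sin (π * (2 * i + 1 : ℕ) / (4 * n)))))
      Filter.atTop (nhds (1 / π)) := by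
  set g : ℝ → ℝ := fun x => 1 / x - cos x / sin x with hg
  have hd : Filter.Tendsto (fun n : ℕ => π / 4 / n) Filter.atTop (nhds 0) :=
    tendsto_const_div_atTop_nhds_zero_nat _
  have hg0 : Filter.Tendsto (fun n : ℕ => g (π / 4 / n)) Filter.atTop (nhds 0) := by
    refine squeeze_zero' ?_ ?_ hd <;>
    filter_upwards [hd.eventually (gt_mem_nhds one_pos), Filter.eventually_gt_atTop 0]
      with n h1 hn
    · exact (inv_sub_cot_mem_Icc (by positivity) h1).1
    · exact (inv_sub_cot_mem_Icc (by positivity) h1).2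
  have hval : g (π / 2) = 2 / π := by simp [hg]
  have hg2 : Filter.Tendsto (fun n : ℕ => g (π / 2 - π / 4 / n)) Filter.atTop (nhds (2 / π)) := by
    have hc : ContinuousAt g (π / 2) := by
      refine (continuousAt_const.div continuousAt_id (by simp [pi_ne_zero])).sub
        (continuous_cos.continuousAt.div continuous_sin.continuousAt (by simp))
    have h := hd.const_sub (π / 2)
    rw [sub_zero] at h
    have := hc.tendsto.comp h
    rw [hval] at this
    exact this
  have bounds : ∀ n : ℕ, 1 ≤ n →
      (2 / π - g (π / 4 / n)) / 2 ≤ ∑ i ∈ range n,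
        (g (π * (2 * i + 2 : ℕ) / (4 * n)) - g (π * (2 * i + 1 : ℕ) / (4 * n))) ∧
      ∑ i ∈ range n,
        (g (π * (2 * i + 2 : ℕ) / (4 * n)) - g (π * (2 * i + 1 : ℕ) / (4 * n))) ≤
        (2 * (2 / π) - g (π / 4 / n) - g (π / 2 - π / 4 / n)) / 2 := by
    intro n hn
    have hn' : (1 : ℝ) ≤ n := by exact_mod_cast hn
    have hn0 : (0 : ℝ) < n := by linarith
    have hb := alternating_sum_bounds (a := fun j : ℕ => g (π * j / (4 * n))) hn ?_ ?_
    · have e1 : π * (2 * n : ℕ) / (4 * (n : ℝ)) = π / 2 := by push_cast; field_simp; norm_num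
      have e2 : π * (1 : ℕ) / (4 * (n : ℝ)) = π / 4 / n := by push_cast; field_simp
      have e3 : π * (2 * n - 1 : ℕ) / (4 * (n : ℝ)) = π / 2 - π / 4 / n := by
        rw [Nat.cast_sub (by omega)]
        push_cast
        field_simp
        ring
      rw [e1, e2, e3, hval] at hb
      constructor <;> linarith [hb.1, hb.2]
    · have := inv_sub_cot_le_two_mul (x := π * 1 / (4 * n)) (by positivity) (by
        rw [mul_one, ← mul_div_assoc, div_le_div_iff₀ (by positivity) two_pos]
        nlinarith [pi_pos])
      rw [show 2 * (π * 1 / (4 * (n : ℝ))) = π * 2 / (4 * n) by ring] at this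
      simpa [hg] using this
    · intro j hj hj'
      have hj1 : (0 : ℝ) < j := by exact_mod_cast hj
      have hj2 : (j : ℝ) + 2 ≤ 2 * n := by exact_mod_cast hj'
      have := two_mul_inv_sub_cot_le (x := π * j / (4 * n)) (d := π / (4 * n)) (by positivity)
        (by positivity) (by
          rw [show π * j / (4 * n) + 2 * (π / (4 * n)) = π * (j + 2) / (4 * (n : ℝ)) by ring,
            div_le_div_iff₀ (by positivity) two_pos]
          nlinarith [pi_pos])
      rw [show π * j / (4 * n) + 2 * (π / (4 * n)) = π * (j + 2 : ℕ) / (4 * (n : ℝ)) by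
          push_cast; ring,
        show π * j / (4 * n) + π / (4 * n) = π * (j + 1 : ℕ) / (4 * (n : ℝ)) by
          push_cast; ring] at this
      exact this
  have l1 := (hg0.const_sub (2 / π)).div_const 2
  have l2 := ((hg0.const_sub (2 * (2 / π))).sub hg2).div_const 2
  rw [show (2 / π - 0) / 2 = 1 / π by ring] at l1
  rw [show (2 * (2 / π) - 0 - 2 / π) / 2 = 1 / π by ring] at l2
  refine tendsto_of_tendsto_of_tendsto_of_le_of_le' l1 l2 ?_ ?_ <;>
  filter_upwards [Filter.eventually_ge_atTop 1] with n hn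
  · exact (bounds n hn).1
  · exact (bounds n hn).2

theorem tendsto_log_two_sub_alternating_harmonic :
    Filter.Tendsto (fun n : ℕ => log 2 - ∑ i ∈ range n,
      ((1 : ℝ) / (2 * i + 1 : ℕ) - 1 / (2 * i + 2 : ℕ))) Filter.atTop (nhds 0) := by
  have hsum : ∀ n : ℕ, ∑ i ∈ range n, ((1 : ℝ) / (2 * i + 1 : ℕ) - 1 / (2 * i + 2 : ℕ)) =
      (harmonic (2 * n) : ℝ) - harmonic n := by
    intro n
    induction n with
    | zero => simp
    | succ n ih =>
      rw [Finset.sum_range_succ, ih, show 2 * (n + 1) = 2 * n + 1 + 1 by ring, harmonic_succ,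
        harmonic_succ, harmonic_succ]
      push_cast
      field_simp
      ring
  have h2 := tendsto_harmonic_sub_log.comp
    (Filter.tendsto_id.const_mul_atTop' (two_pos : 0 < 2) : Filter.Tendsto (fun n : ℕ => 2 * n) _ _)
  have h := tendsto_harmonic_sub_log.sub h2
  rw [sub_self] at h
  refine h.congr' ?_
  filter_upwards [Filter.eventually_gt_atTop 0] with n hn
  have hn' : (n : ℝ) ≠ 0 := by exact_mod_cast hn.ne'
  rw [hsum]
  simp only [Function.comp]
  push_cast
  rw [log_mul two_ne_zero hn']
  ring

theorem log_two_sub_alternating_harmonic_bounds {n : ℕ} (hn : 1 ≤ n) :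
    1 / (4 * n + 2 : ℝ) ≤ log 2 - ∑ i ∈ range n,
        ((1 : ℝ) / (2 * i + 1 : ℕ) - 1 / (2 * i + 2 : ℕ)) ∧
      log 2 - ∑ i ∈ range n, ((1 : ℝ) / (2 * i + 1 : ℕ) - 1 / (2 * i + 2 : ℕ)) ≤
        1 / (4 * n : ℝ) := by
  have hlim := tendsto_log_two_sub_alternating_harmonic
  set e : ℕ → ℝ := fun n => log 2 - ∑ i ∈ range n,
    ((1 : ℝ) / (2 * i + 1 : ℕ) - 1 / (2 * i + 2 : ℕ)) with he
  have step : ∀ k, e k = e (k + 1) + 1 / ((2 * k + 1) * (2 * k + 2)) := by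
    intro k
    simp only [he, Finset.sum_range_succ]
    push_cast
    field_simp
    ring
  have l0 : Filter.Tendsto (fun n : ℕ => 1 / (4 : ℝ) / n) Filter.atTop (nhds 0) :=
    tendsto_const_div_atTop_nhds_zero_nat _
  have l2 : Filter.Tendsto (fun n : ℕ => 1 / (4 * n + 2 : ℝ)) Filter.atTop (nhds 0) := by
    refine squeeze_zero' (Filter.Eventually.of_forall fun n => by positivity) ?_ l0
    filter_upwards [Filter.eventually_gt_atTop 0] with n hn
    have hn' : (0 : ℝ) < n := by exact_mod_cast hn
    rw [div_div]
    exact one_div_le_one_div_of_le (by positivity) (by linarith)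
  constructor
  · have anti : Antitone fun k => e k - 1 / (4 * k + 2 : ℝ) := by
      refine antitone_nat_of_succ_le fun k => ?_
      rw [step k]
      have h1 : 1 / (4 * (k : ℝ) + 2) - 1 / (4 * (k + 1 : ℕ) + 2) =
          1 / ((2 * k + 1) * (2 * k + 3)) := by
        push_cast
        field_simp
        ring
      have h2 : 1 / ((2 * k + 1) * (2 * k + 3) : ℝ) ≤ 1 / ((2 * k + 1) * (2 * k + 2)) := by
        gcongr
        norm_num
      linarith
    have h := hlim.sub l2
    rw [sub_zero] at h
    exact sub_nonneg.1 (anti.le_of_tendsto h n)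
  · have h := hlim.sub l0
    rw [sub_zero] at h
    have mono : ∀ m, n ≤ m → e n - 1 / 4 / (n : ℝ) ≤ e m - 1 / 4 / (m : ℝ) := by
      intro m hm
      induction m, hm using Nat.le_induction with
      | base => exact le_rfl
      | succ k hk ih =>
        refine ih.trans ?_
        have hk0 : (0 : ℝ) < k := by exact_mod_cast (by omega : 0 < k)
        rw [step k]
        have h1 : 1 / 4 / (k : ℝ) - 1 / 4 / (k + 1 : ℕ) = 1 / (2 * k * (2 * k + 2)) := by
          push_cast
          field_simp
          ring
        have h2 : 1 / ((2 * k + 1) * (2 * k + 2) : ℝ) ≤ 1 / (2 * k * (2 * k + 2)) := by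
          gcongr
          linarith
        linarith
    have := ge_of_tendsto h (Filter.eventually_atTop.2 ⟨n, mono⟩)
    rw [div_div] at this
    linarith

theorem tendsto_mul_log_two_sub_alternating_harmonic :
    Filter.Tendsto (fun n : ℕ => 4 * n / π * (log 2 - ∑ i ∈ range n,
      ((1 : ℝ) / (2 * i + 1 : ℕ) - 1 / (2 * i + 2 : ℕ)))) Filter.atTop (nhds (1 / π)) := by
  have l0 := (tendsto_const_div_atTop_nhds_zero_nat (1 / (2 * π))).const_sub (1 / π)
  rw [sub_zero] at l0
  refine tendsto_of_tendsto_of_tendsto_of_le_of_le' l0 tendsto_const_nhds ?_ ?_ <;>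
  filter_upwards [Filter.eventually_ge_atTop 1] with n hn
  all_goals
    have hb := log_two_sub_alternating_harmonic_bounds hn
    have hn' : (0 : ℝ) < n := by exact_mod_cast hn
  · refine le_trans ?_ (mul_le_mul_of_nonneg_left hb.1 (by positivity))
    rw [← sub_nonneg, show 4 * n / π * (1 / (4 * n + 2)) - (1 / π - 1 / (2 * π) / n) =
      1 / (2 * π * n * (2 * n + 1)) by field_simp; ring]
    positivity
  · refine (mul_le_mul_of_nonneg_left hb.2 (by positivity)).trans (le_of_eq ?_)
    field_simp

theorem sum_alternating_cot (n : ℕ) :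
    ∑ l ∈ range (2 * n + 1), (-1 : ℝ) ^ l * (cos (π * l / (2 * n)) / sin (π * l / (2 * n))) = 0 := by
  rcases Nat.eq_zero_or_pos n with rfl | hn
  · simp
  have hn' : (n : ℝ) ≠ 0 := by exact_mod_cast hn.ne'
  set f : ℕ → ℝ := fun l => (-1 : ℝ) ^ l * (cos (π * l / (2 * n)) / sin (π * l / (2 * n))) with hf
  have hneg : ∑ l ∈ range (2 * n + 1), f l = ∑ l ∈ range (2 * n + 1), -f l := by
    rw [← Finset.sum_flip]
    refine Finset.sum_congr rfl fun l hl => ?_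
    have hl : l ≤ 2 * n := Nat.lt_succ_iff.1 (Finset.mem_range.1 hl)
    have e : π * (2 * n - l : ℕ) / (2 * (n : ℝ)) = π - π * l / (2 * n) := by
      rw [Nat.cast_sub hl]
      push_cast
      field_simp
    have e2 : (-1 : ℝ) ^ (2 * n - l) = (-1) ^ l := by
      rcases Nat.even_or_odd l with h | h
      · rw [h.neg_one_pow, Even.neg_one_pow (by grind)]
      · rw [h.neg_one_pow, Odd.neg_one_pow (by grind)]
    simp only [hf]
    rw [e, e2, cos_pi_sub, sin_pi_sub]
    ring
  rw [Finset.sum_neg_distrib] at hneg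
  linarith

theorem C_two_mul_self {n : ℕ} (hn : 0 < n) :
    C (2 * n) n = ∑ i ∈ range n,
      (cos (π * (2 * i + 2 : ℕ) / (4 * n)) / sin (π * (2 * i + 2 : ℕ) / (4 * n)) -
        cos (π * (2 * i + 1 : ℕ) / (4 * n)) / sin (π * (2 * i + 1 : ℕ) / (4 * n))) := by
  have hn' : (0 : ℝ) < n := by exact_mod_cast hn
  have hterm : ∀ l ∈ range (2 * n),
      cos (2 * π * (n : ℤ) * l / (2 * n : ℕ)) / sin (π * l / (2 * n : ℕ)) =
      (-1) ^ l * (cos (π * l / (4 * n)) / sin (π * l / (4 * n))) -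
        (-1) ^ l * (cos (π * l / (2 * n)) / sin (π * l / (2 * n))) := by
    intro l hl
    rcases Nat.eq_zero_or_pos l with rfl | hl0
    · simp
    have hl' : (l : ℝ) < 2 * n := by exact_mod_cast Finset.mem_range.1 hl
    have hl0' : (0 : ℝ) < l := by exact_mod_cast hl0
    push_cast
    rw [show 2 * π * (n : ℝ) * l / (2 * n) = l * π by field_simp, cos_nat_mul_pi,
      show π * (l : ℝ) / (2 * n) = 2 * (π * l / (4 * n)) by field_simp; norm_num]
    have hy : π * (l : ℝ) / (4 * n) < π / 2 := by
      rw [div_lt_div_iff₀ (by positivity) two_pos]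
      nlinarith [pi_pos]
    have hy0 : 0 < π * (l : ℝ) / (4 * n) := by positivity
    generalize π * (l : ℝ) / (4 * n) = y at *
    have hs : 0 < sin y := sin_pos_of_pos_of_lt_pi hy0 (by linarith)
    have hc : 0 < cos y := cos_pos_of_mem_Ioo ⟨by linarith, hy⟩
    rw [sin_two_mul, cos_two_mul]
    field_simp
    ring
  have hcot := sum_alternating_cot n
  have e1 : π * (2 * n : ℕ) / (2 * (n : ℝ)) = π := by push_cast; field_simp
  have e2 : π * (2 * n : ℕ) / (4 * (n : ℝ)) = π / 2 := by push_cast; field_simp; norm_num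
  rw [Finset.sum_range_succ, e1, sin_pi, div_zero, mul_zero, add_zero] at hcot
  rw [C_eq_sum_range, Finset.sum_congr rfl hterm, Finset.sum_sub_distrib, hcot, sub_zero]
  have hlast : ∑ l ∈ range (2 * n), (-1 : ℝ) ^ l * (cos (π * l / (4 * n)) / sin (π * l / (4 * n))) =
      ∑ l ∈ range (2 * n + 1), (-1 : ℝ) ^ l * (cos (π * l / (4 * n)) / sin (π * l / (4 * n))) := by
    rw [Finset.sum_range_succ, e2, cos_pi_div_two, zero_div, mul_zero, add_zero]
  rw [hlast, Finset.sum_range_succ', sum_range_two_mul]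
  simp only [Nat.cast_zero, mul_zero, zero_div, sin_zero, div_zero, add_zero]
  refine Finset.sum_congr rfl fun i _ => ?_
  rw [Odd.neg_one_pow ⟨i, rfl⟩, Even.neg_one_pow ⟨i + 1, by ring⟩]
  ring_nf

theorem tendsto_C_two_mul_self :
    Filter.Tendsto (fun n : ℕ => C (2 * n) n + 4 * n / π * log 2) Filter.atTop (nhds 0) := by
  have h := tendsto_mul_log_two_sub_alternating_harmonic.sub tendsto_sum_inv_sub_cot
  rw [sub_self] at h
  refine h.congr' ?_
  filter_upwards [Filter.eventually_gt_atTop 0] with n hn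
  have hn' : (n : ℝ) ≠ 0 := by exact_mod_cast hn.ne'
  rw [C_two_mul_self hn, mul_sub, sub_sub, sub_eq_iff_eq_add, Finset.mul_sum]
  rw [add_assoc, add_comm (4 * (n : ℝ) / π * log 2), ← add_assoc, right_eq_add,
    ← Finset.sum_add_distrib, ← Finset.sum_add_distrib]
  refine Finset.sum_eq_zero fun i _ => ?_
  push_cast
  field_simp
  ring

theorem C_bounds :
    (∀ n : ℕ, 2 ≤ n → ∀ ν : ℕ, 1 ≤ ν → ν ≤ n - 1 →
      -(2 * n / π) * Real.log (2 * Real.sin (π * ν / n))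
          - (π / (12 * n)) * (1 / Real.sin (π * ν / n)) ^ 2
        < C n (ν : ℤ) ∧
      C n (ν : ℤ)
        < -(2 * n / π) * Real.log (2 * Real.sin (π * ν / n))
            - (π / (12 * n)) * (1 / Real.sin (π * ν / n)) ^ 2
            + (7 * π ^ 3 / (1440 * (n : ℝ) ^ 3)) * (1 + 2 * Real.cos (π * ν / n) ^ 2)
                * (1 / Real.sin (π * ν / n)) ^ 4) ∧
    (∀ n : ℕ, 2 ≤ n → Even n →
      2 * n * Real.log 2 / π + π / (12 * n) - 7 * π ^ 3 / (1440 * (n : ℝ) ^ 3)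
          < ∑ l ∈ Finset.Icc 1 (n - 1), (-1 : ℝ) ^ (l + 1) * (1 / Real.sin (π * l / n)) ∧
      ∑ l ∈ Finset.Icc 1 (n - 1), (-1 : ℝ) ^ (l + 1) * (1 / Real.sin (π * l / n))
          < 2 * n * Real.log 2 / π + π / (12 * n)) := by
  refine ⟨fun n hn ν h1 h2 => C_bounds_of_tendsto tendsto_C_two_mul_self h1 (by omega), ?_⟩
  intro n hn heven
  obtain ⟨m, rfl⟩ := heven.two_dvd
  have hm : (m : ℝ) ≠ 0 := by exact_mod_cast (by omega : m ≠ 0)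
  have hsum : ∑ l ∈ Finset.Icc 1 (2 * m - 1),
      (-1 : ℝ) ^ (l + 1) * (1 / Real.sin (π * l / (2 * m : ℕ))) = -C (2 * m) m := by
    rw [C, ← Finset.sum_neg_distrib]
    refine Finset.sum_congr rfl fun l _ => ?_
    rw [show 2 * π * ((m : ℤ) : ℝ) * l / (2 * m : ℕ) = l * π by push_cast; field_simp,
      cos_nat_mul_pi, pow_succ]
    ring
  obtain ⟨hl, hu⟩ := C_bounds_of_tendsto tendsto_C_two_mul_self
    (show 0 < m by omega) (show m < 2 * m by omega)
  rw [show π * (m : ℝ) / (2 * m : ℕ) = π / 2 by push_cast; field_simp] at hl hu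
  simp only [cscMain, cscCorrection, sin_pi_div_two, cos_pi_div_two] at hl hu
  rw [hsum, mul_div_right_comm]
  constructor <;> linarith
end
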